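/- arXiv:0811.3552 — 5 statements merged into one kernel-verified Lean document; each statement's English description precedes it below -/
import Mathlib

section
/- Suppose F is in the Gumbel max-domain of attraction with positive scaling function w. Let Q^{−1} denote the generalized inverse of Q and set b_*(u) := α_ρ · Q^{−1}(1−1/u). Then as u → ∞, S̃_u(1,1) = (1+o(1)) · [α_ρ² (1−ρ²)^{3/2} / (2π (1−ρ)²)] · (1−F(b_*(u))) / (b_*(u) · w(b_*(u))); i.e., the ratio of S̃_u(1,1) to the displayed expression tends to 1. -/
open MeasureTheory ProbabilityTheory Filter Real

/-- The uniform distribution on the unit circle of `ℝ²`, obtained as the pushforward of the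
normalized Lebesgue measure on `(0, 2π]` under the parametrization `θ ↦ (cos θ, sin θ)`. -/
noncomputable def uniformCircle : Measure (ℝ × ℝ) :=
  Measure.map (fun θ : ℝ => (Real.cos θ, Real.sin θ))
    ((ENNReal.ofReal (2 * Real.pi))⁻¹ • volume.restrict (Set.Ioc 0 (2 * Real.pi)))

/-- `G` is a survival function supported on the positive half-line, with everywhere positive
values, in the Gumbel max-domain of attraction with scaling function `w`. -/
structure GumbelTail (G w : ℝ → ℝ) : Prop where
  antitone : Antitone G
  pos : ∀ x, 0 < G x
  eq_one : ∀ x ≤ 0, G x = 1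
  tendsto_zero : Tendsto G atTop (nhds 0)
  scaling_pos : ∀ u, 0 < w u
  gumbel : ∀ x : ℝ, Tendsto (fun u => G (u + x / w u) / G u) atTop (nhds (Real.exp (-x)))

namespace GumbelTail

variable {G w : ℝ → ℝ}

lemma tendsto_mul_scaling (h : GumbelTail G w) : Tendsto (fun u => u * w u) atTop atTop := by
  refine tendsto_atTop.2 fun K => ?_
  have h1 := (h.gumbel (-K)).eventually (gt_mem_nhds (lt_add_one (Real.exp (-(-K)))))
  have hC : (0 : ℝ) < (Real.exp (-(-K)) + 1)⁻¹ := by positivity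
  have h2 := h.tendsto_zero.eventually (gt_mem_nhds hC)
  filter_upwards [h1, h2] with u hu1 hu2
  have hw := h.scaling_pos u
  by_contra! hlt
  have hle : u + -K / w u ≤ 0 := by
    have : u < K / w u := by rwa [lt_div_iff₀ hw]
    rw [neg_div]
    linarith
  rw [h.eq_one _ hle, div_lt_iff₀ (h.pos u)] at hu1
  have : (Real.exp (-(-K)) + 1) * G u < 1 := by
    calc _ < (Real.exp (-(-K)) + 1) * (Real.exp (-(-K)) + 1)⁻¹ := by gcongr
      _ = 1 := mul_inv_cancel₀ (by positivity)
  linarith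

lemma tendsto_add_inv_scaling (h : GumbelTail G w) :
    Tendsto (fun u => u + 1 / w u) atTop atTop :=
  tendsto_atTop_mono (fun u => by have := h.scaling_pos u; simp [this.le]) tendsto_id

lemma eventually_scaling_le (h : GumbelTail G w) :
    ∀ᶠ u in atTop, 1 / w (u + 1 / w u) ≤ 3 / 2 * (1 / w u) := by
  have h1 := (h.gumbel 1)
  have h2 := (h.gumbel 2)
  have h21 := h2.div h1 (Real.exp_pos _).ne'
  have h3 := (h.gumbel (2 / 3)).comp h.tendsto_add_inv_scaling
  have hlt : Real.exp (-2) / Real.exp (-1) < Real.exp (-(2 / 3)) := by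
    rw [← Real.exp_sub]
    exact Real.exp_lt_exp.2 (by norm_num)
  filter_upwards [h21.eventually_lt h3 hlt] with u hu
  have hw := h.scaling_pos u
  by_contra! hgt
  refine absurd hu (not_lt.2 ?_)
  have hv := h.pos (u + 1 / w u)
  have hu0 := h.pos u
  simp only [Function.comp, Pi.div_apply]
  rw [div_div_div_cancel_right₀ hu0.ne']
  gcongr
  apply h.antitone
  have e1 : 2 / w u = 2 * (1 / w u) := by ring
  have e2 : 2 / 3 / w (u + 1 / w u) = 2 / 3 * (1 / w (u + 1 / w u)) := by ring
  rw [e1, e2]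
  linarith

lemma exists_geometric_bound (h : GumbelTail G w) :
    ∃ u₀ : ℝ, ∀ n : ℕ, ∀ u ≥ u₀,
      G (u + 2 * ((3 / 2) ^ n - 1) * (1 / w u)) ≤ (4 / 9) ^ n * G u := by
  have hexp : Real.exp (-1) < 4 / 9 := by
    rw [Real.exp_neg, inv_lt_comm₀ (Real.exp_pos _) (by norm_num)]
    have := Real.exp_one_gt_d9
    norm_num at this ⊢
    linarith
  obtain ⟨u₀, hu₀⟩ := eventually_atTop.1
    (h.eventually_scaling_le.and ((h.gumbel 1).eventually (gt_mem_nhds hexp)))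
  refine ⟨u₀, fun n => ?_⟩
  induction n with
  | zero => intro u _; simp
  | succ n ih =>
    intro u hu
    obtain ⟨ha, hG⟩ := hu₀ u hu
    have hw := h.scaling_pos u
    have hG' : G (u + 1 / w u) ≤ 4 / 9 * G u := ((div_lt_iff₀ (h.pos u)).1 hG).le
    have hn : (1 : ℝ) ≤ (3 / 2) ^ n := one_le_pow₀ (by norm_num)
    have hv : u + 1 / w u ≥ u₀ := by
      have : 0 < 1 / w u := by positivity
      linarith
    calc G (u + 2 * ((3 / 2) ^ (n + 1) - 1) * (1 / w u))
        ≤ G (u + 1 / w u + 2 * ((3 / 2) ^ n - 1) * (1 / w (u + 1 / w u))) := by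
          apply h.antitone
          have := mul_le_mul_of_nonneg_left ha (by linarith : (0 : ℝ) ≤ 2 * ((3 / 2) ^ n - 1))
          rw [pow_succ]
          linarith
      _ ≤ (4 / 9) ^ n * G (u + 1 / w u) := ih _ hv
      _ ≤ (4 / 9) ^ n * (4 / 9 * G u) := by gcongr
      _ = (4 / 9) ^ (n + 1) * G u := by ring

lemma eventually_le_inv_one_add_sq (h : GumbelTail G w) :
    ∀ᶠ u in atTop, ∀ z ≥ 0, G (u + z / w u) ≤ 9 * (1 + z ^ 2)⁻¹ * G u := by
  obtain ⟨u₀, hu₀⟩ := h.exists_geometric_bound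
  filter_upwards [eventually_ge_atTop u₀] with u hu z hz
  obtain ⟨n, hn1, hn2⟩ := exists_nat_pow_near (by linarith : (1 : ℝ) ≤ 1 + z / 2)
    (by norm_num : (1 : ℝ) < 3 / 2)
  have hw := h.scaling_pos u
  have hG := h.pos u
  calc G (u + z / w u) ≤ G (u + 2 * ((3 / 2) ^ n - 1) * (1 / w u)) := by
        apply h.antitone
        rw [div_eq_mul_one_div z]
        gcongr
        linarith
    _ ≤ (4 / 9) ^ n * G u := hu₀ n u hu
    _ ≤ 9 * (1 + z ^ 2)⁻¹ * G u := by
        gcongr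
        have e : ((4 : ℝ) / 9) ^ n = (((3 / 2) ^ n) ^ 2)⁻¹ := by
          rw [← pow_mul, mul_comm n 2, pow_mul, ← inv_pow]; norm_num
        rw [e, ← div_eq_mul_inv, inv_le_comm₀ (by positivity) (by positivity), inv_div,
          div_le_iff₀ (by norm_num)]
        rw [pow_succ] at hn2
        have : 1 + z / 2 ≤ (3 / 2) * (3 / 2) ^ n := by linarith
        have h2 : (1 + z / 2) ^ 2 ≤ ((3 / 2) * (3 / 2 : ℝ) ^ n) ^ 2 := by gcongr
        nlinarith

lemma tendsto_of_tendsto (h : GumbelTail G w) {y : ℝ → ℝ} {x : ℝ}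
    (hy : Tendsto y atTop (nhds x)) :
    Tendsto (fun u => G (u + y u / w u) / G u) atTop (nhds (Real.exp (-x))) := by
  refine tendsto_order.2 ⟨fun a ha => ?_, fun a ha => ?_⟩
  · have hc : ∀ᶠ t in nhdsWithin x (Set.Ioi x), a < Real.exp (-t) :=
      ((by fun_prop : Continuous fun t : ℝ => Real.exp (-t)).tendsto x).mono_left
        nhdsWithin_le_nhds |>.eventually (lt_mem_nhds ha)
    obtain ⟨t, hat, hxt⟩ := (hc.and self_mem_nhdsWithin).exists
    filter_upwards [(h.gumbel t).eventually (lt_mem_nhds hat), hy.eventually (gt_mem_nhds hxt)]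
      with u hu hyu
    have hw := h.scaling_pos u
    have hG := h.pos u
    refine hu.trans_le ?_
    gcongr
    apply h.antitone
    gcongr
  · have hc : ∀ᶠ t in nhdsWithin x (Set.Iio x), Real.exp (-t) < a :=
      ((by fun_prop : Continuous fun t : ℝ => Real.exp (-t)).tendsto x).mono_left
        nhdsWithin_le_nhds |>.eventually (gt_mem_nhds ha)
    obtain ⟨t, hat, hxt⟩ := (hc.and self_mem_nhdsWithin).exists
    filter_upwards [(h.gumbel t).eventually (gt_mem_nhds hat), hy.eventually (lt_mem_nhds hxt)]
      with u hu hyu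
    have hw := h.scaling_pos u
    have hG := h.pos u
    refine lt_of_le_of_lt ?_ hu
    gcongr
    apply h.antitone
    gcongr

end GumbelTail

lemma one_add_mul_tan_le_cos_div_cos {β φ : ℝ} (hβ : 0 < β) (hφ : 0 ≤ φ)
    (hβφ : φ < Real.pi / 2 - β) :
    1 + φ * Real.tan β ≤ Real.cos β / Real.cos (β + φ) := by
  have hc : 0 < Real.cos β := Real.cos_pos_of_mem_Ioo ⟨by linarith, by linarith⟩
  have hs : 0 < Real.sin β := Real.sin_pos_of_pos_of_lt_pi hβ (by linarith)
  have hcφ : 0 < Real.cos φ := Real.cos_pos_of_mem_Ioo ⟨by linarith, by linarith⟩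
  have hcβφ : 0 < Real.cos (β + φ) := Real.cos_pos_of_mem_Ioo ⟨by linarith, by linarith⟩
  have hsφ : 0 ≤ Real.sin φ := Real.sin_nonneg_of_nonneg_of_le_pi hφ (by linarith)
  have htan : φ * Real.cos φ ≤ Real.sin φ := by
    have := Real.le_tan hφ (by linarith)
    rwa [Real.tan_eq_sin_div_cos, le_div_iff₀ hcφ] at this
  have key : (Real.cos β + φ * Real.sin β) * Real.cos (β + φ) ≤ Real.cos β ^ 2 := by
    rw [Real.cos_add]
    have h1 := mul_le_mul_of_nonneg_left htan (mul_pos hc hs).le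
    have h2 := mul_le_mul_of_nonneg_left (Real.cos_le_one φ) (sq_nonneg (Real.cos β))
    have h3 : 0 ≤ φ * Real.sin β ^ 2 * Real.sin φ := by positivity
    nlinarith
  rw [le_div_iff₀ hcβφ, Real.tan_eq_sin_div_cos]
  have : (1 + φ * (Real.sin β / Real.cos β)) * Real.cos (β + φ)
      = (Real.cos β + φ * Real.sin β) * Real.cos (β + φ) / Real.cos β := by
    field_simp
  rw [this, div_le_iff₀ hc]
  nlinarith

lemma hasDerivAt_cos_div_cos {β : ℝ} (hβ : Real.cos β ≠ 0) :
    HasDerivAt (fun φ => Real.cos β / Real.cos (β + φ)) (Real.tan β) 0 := by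
  have h1 : HasDerivAt (fun φ => Real.cos (β + φ)) (-Real.sin β) 0 := by
    simpa using ((hasDerivAt_id (0 : ℝ)).const_add β).cos
  have h2 := (h1.inv (by simpa using hβ)).const_mul (Real.cos β)
  refine h2.congr_deriv ?_
  rw [Real.tan_eq_sin_div_cos]
  simp only [add_zero]
  field_simp

lemma tendsto_mul_sub_of_hasDerivAt {k s : ℝ → ℝ} {k' y : ℝ} (hk : HasDerivAt k k' 0)
    (hs : Tendsto s atTop atTop) (hy : 0 < y) :
    Tendsto (fun u => s u * (k (y / s u) - k 0)) atTop (nhds (y * k')) := by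
  have h0 : Tendsto (fun u => y / s u) atTop (nhdsWithin 0 {0}ᶜ) := by
    refine tendsto_nhdsWithin_iff.2 ⟨tendsto_const_nhds.div_atTop hs, ?_⟩
    filter_upwards [hs.eventually_gt_atTop 0] with u hu
    exact (div_pos hy hu).ne'
  have h1 := ((hasDerivAt_iff_tendsto_slope.1 hk).comp h0).const_mul y
  refine h1.congr' ?_
  filter_upwards [hs.eventually_gt_atTop 0] with u hu
  simp only [Function.comp, slope_def_field, sub_zero]
  field_simp

lemma GumbelTail.tendsto_integral_div {G w : ℝ → ℝ} (h : GumbelTail G w) {β : ℝ}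
    (hβ : β ∈ Set.Ioo 0 (Real.pi / 2)) :
    Tendsto (fun B => (∫ φ in (0 : ℝ)..Real.pi / 2 - β,
        G (B * Real.cos β / Real.cos (β + φ))) / (G B / (B * w B)))
      atTop (nhds (Real.cos β / Real.sin β)) := by
  obtain ⟨hβ0, hβ1⟩ := hβ
  have hc : 0 < Real.cos β := Real.cos_pos_of_mem_Ioo ⟨by linarith, by linarith⟩
  have hs : 0 < Real.sin β := Real.sin_pos_of_pos_of_lt_pi hβ0 (by linarith)
  have ht : 0 < Real.tan β := Real.tan_pos_of_pos_of_lt_pi_div_two hβ0 hβ1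
  set f : ℝ → ℝ → ℝ := fun B => (Set.Iio ((Real.pi / 2 - β) * (B * w B))).indicator
    fun y => G (B * Real.cos β / Real.cos (β + y / (B * w B))) / G B with hf
  have hlim : Tendsto (fun B => ∫ y in Set.Ioi 0, f B y) atTop
      (nhds (∫ y in Set.Ioi (0 : ℝ), Real.exp (-Real.tan β * y))) := by
    refine tendsto_integral_filter_of_dominated_convergence
      (fun y => 9 * (1 + (Real.tan β * y) ^ 2)⁻¹) ?_ ?_ ?_ ?_
    · refine Eventually.of_forall fun B => ?_
      refine Measurable.aestronglyMeasurable ?_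
      refine Measurable.indicator ?_ measurableSet_Iio
      exact (h.antitone.measurable.comp (by fun_prop)).div_const _
    · filter_upwards [h.eventually_le_inv_one_add_sq, eventually_gt_atTop 0] with B hB hB0
      filter_upwards [ae_restrict_mem measurableSet_Ioi] with y hy
      have hy : 0 < y := hy
      have hw := h.scaling_pos B
      have hG := h.pos B
      simp only [hf]
      by_cases hyB : y ∈ Set.Iio ((Real.pi / 2 - β) * (B * w B))
      · rw [Set.indicator_of_mem hyB, Real.norm_of_nonneg (div_pos (h.pos _) hG).le,
          div_le_iff₀ hG]
        refine le_trans (h.antitone ?_) (hB (Real.tan β * y) (by positivity))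
        have := one_add_mul_tan_le_cos_div_cos (φ := y / (B * w B)) hβ0 (by positivity)
          ((div_lt_iff₀ (by positivity)).2 hyB)
        calc B + Real.tan β * y / w B = B * (1 + y / (B * w B) * Real.tan β) := by field_simp
          _ ≤ B * (Real.cos β / Real.cos (β + y / (B * w B))) := by gcongr
          _ = _ := by ring
      · rw [Set.indicator_of_notMem hyB]
        simp only [norm_zero]
        positivity
    · exact ((integrable_inv_one_add_sq.comp_mul_left' ht.ne').const_mul 9).integrableOn
    · filter_upwards [ae_restrict_mem measurableSet_Ioi] with y hy
      have hy : 0 < y := hy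
      have h1 := h.tendsto_of_tendsto (tendsto_mul_sub_of_hasDerivAt
        (hasDerivAt_cos_div_cos hc.ne') h.tendsto_mul_scaling hy)
      rw [show -Real.tan β * y = -(y * Real.tan β) by ring]
      refine h1.congr' ?_
      filter_upwards [(h.tendsto_mul_scaling.const_mul_atTop
        (sub_pos.2 hβ1)).eventually_gt_atTop y] with B hB
      have hw := h.scaling_pos B
      rw [hf]
      simp only
      rw [Set.indicator_of_mem (show y ∈ Set.Iio _ from hB)]
      congr 2
      simp only [add_zero, div_self hc.ne']
      field_simp
      ring
  have hval : ∫ y in Set.Ioi (0 : ℝ), Real.exp (-Real.tan β * y)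
      = Real.cos β / Real.sin β := by
    rw [integral_exp_mul_Ioi (neg_lt_zero.2 ht), Real.tan_eq_sin_div_cos]
    simp
  rw [hval] at hlim
  refine hlim.congr' ?_
  filter_upwards [eventually_gt_atTop 0] with B hB0
  have hw := h.scaling_pos B
  have hG := h.pos B
  have hBw : 0 < B * w B := by positivity
  have hend : 0 ≤ (Real.pi / 2 - β) * (B * w B) := mul_nonneg (by linarith) hBw.le
  rw [hf]
  simp only
  rw [setIntegral_indicator measurableSet_Iio, Set.Ioi_inter_Iio, ← integral_Ioc_eq_integral_Ioo,
    ← intervalIntegral.integral_of_le hend, intervalIntegral.integral_div,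
    intervalIntegral.integral_comp_div
      (fun φ => G (B * Real.cos β / Real.cos (β + φ))) hBw.ne', zero_div,
    mul_div_cancel_right₀ _ hBw.ne', smul_eq_mul]
  field_simp

lemma continuous_cdf_of_nullSingletonClass (ν : Measure ℝ) [IsProbabilityMeasure ν]
    [NullSingletonClass ν] : Continuous (cdf ν) := by
  refine continuous_iff_continuousAt.2 fun x => ?_
  rw [(monotone_cdf ν).continuousAt_iff_leftLim_eq_rightLim, (cdf ν).rightLim_eq]
  refine le_antisymm ((monotone_cdf ν).leftLim_le le_rfl) ?_
  have h := (cdf ν).measure_singleton x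
  rw [measure_cdf, measure_singleton] at h
  linarith [ENNReal.ofReal_eq_zero.1 h.symm]

lemma cdf_superlevel_ae_eq_Ioi (ν : Measure ℝ) [IsProbabilityMeasure ν] [NullSingletonClass ν]
    {p : ℝ} (hp0 : 0 < p) (hp1 : p < 1) :
    {x | p < cdf ν x} =ᵐ[ν] Set.Ioi (sInf {t | p ≤ cdf ν t}) := by
  have hcont := continuous_cdf_of_nullSingletonClass ν
  have hmono := monotone_cdf ν
  set S : Set ℝ := {t | p ≤ cdf ν t} with hS
  have hSne : S.Nonempty :=
    (((tendsto_cdf_atTop ν).eventually (lt_mem_nhds hp1)).exists).imp fun _ h => h.le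
  have hSbdd : BddBelow S := by
    obtain ⟨a, ha⟩ := ((tendsto_cdf_atBot ν).eventually (gt_mem_nhds hp0)).exists
    exact ⟨a, fun t ht => (hmono.reflect_lt (lt_of_lt_of_le ha ht)).le⟩
  have hbS : p ≤ cdf ν (sInf S) :=
    (isClosed_le continuous_const hcont).csInf_mem hSne hSbdd
  have hbp : cdf ν (sInf S) ≤ p := by
    refine le_of_tendsto (hcont.continuousAt.continuousWithinAt (s := Set.Iio (sInf S))) ?_
    filter_upwards [self_mem_nhdsWithin] with t ht
    by_contra! hlt
    exact absurd (csInf_le hSbdd (show t ∈ S from hlt.le)) (not_le.2 ht)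
  set T : Set ℝ := {t | cdf ν t ≤ p} with hT
  have hTbdd : BddAbove T := by
    obtain ⟨a, ha⟩ := ((tendsto_cdf_atTop ν).eventually (lt_mem_nhds hp1)).exists
    exact ⟨a, fun t ht => (hmono.reflect_lt (lt_of_le_of_lt ht ha)).le⟩
  have hcT : cdf ν (sSup T) ≤ p :=
    (isClosed_le hcont continuous_const).csSup_mem ⟨_, hbp⟩ hTbdd
  have hnull : ν (Set.Ioc (sInf S) (sSup T)) = 0 := by
    rw [← measure_cdf ν, StieltjesFunction.measure_Ioc, ENNReal.ofReal_eq_zero]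
    linarith
  refine ae_eq_set.2 ⟨?_, ?_⟩
  · convert measure_empty (μ := ν)
    refine Set.eq_empty_of_forall_notMem fun x hx => hx.2 ?_
    exact hmono.reflect_lt (lt_of_le_of_lt hbp hx.1)
  · refine measure_mono_null (fun x hx => ?_) hnull
    have hxp : cdf ν x ≤ p := not_lt.1 hx.2
    exact ⟨hx.1, le_csSup hTbdd hxp⟩

lemma tendsto_sInf_cdf_atTop (ν : Measure ℝ) (h : ∀ t, cdf ν t < 1) :
    Tendsto (fun u : ℝ => sInf {t | 1 - 1 / u ≤ cdf ν t}) atTop atTop := by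
  refine tendsto_atTop.2 fun M => ?_
  have hlim : Tendsto (fun u : ℝ => 1 - 1 / u) atTop (nhds 1) := by
    simpa using (tendsto_inv_atTop_zero (𝕜 := ℝ)).const_sub 1
  filter_upwards [hlim.eventually (lt_mem_nhds (h M)), eventually_gt_atTop 0] with u hu hu0
  have hlt : 1 - 1 / u < 1 := sub_lt_self _ (by positivity)
  refine le_csInf ?_ fun t ht => ?_
  · exact (((tendsto_cdf_atTop ν).eventually (lt_mem_nhds hlt)).exists).imp fun _ h => h.le
  · exact ((monotone_cdf ν).reflect_lt (lt_of_lt_of_le hu ht)).le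

instance : IsProbabilityMeasure uniformCircle := by
  have hpi := Real.two_pi_pos
  have : IsProbabilityMeasure ((ENNReal.ofReal (2 * Real.pi))⁻¹ •
      (volume : Measure ℝ).restrict (Set.Ioc 0 (2 * Real.pi))) := by
    constructor
    rw [Measure.smul_apply, Measure.restrict_apply_univ, Real.volume_Ioc, sub_zero, smul_eq_mul]
    exact ENNReal.inv_mul_cancel (by simpa using hpi) ENNReal.ofReal_ne_top
  exact Measure.isProbabilityMeasure_map (by fun_prop)

lemma uniformCircle_apply {A : Set (ℝ × ℝ)} (hA : MeasurableSet A) :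
    uniformCircle A = (ENNReal.ofReal (2 * Real.pi))⁻¹ *
      volume ({θ : ℝ | (Real.cos θ, Real.sin θ) ∈ A} ∩ Set.Ioc 0 (2 * Real.pi)) := by
  have hm : Measurable fun θ : ℝ => (Real.cos θ, Real.sin θ) := by fun_prop
  rw [uniformCircle, Measure.map_apply hm hA, Measure.smul_apply,
    Measure.restrict_apply (hm hA), smul_eq_mul]
  rfl

lemma countable_setOf_cos_eq (c : ℝ) : {θ : ℝ | Real.cos θ = c}.Countable := by
  by_cases h : ∃ x, Real.cos x = c
  · obtain ⟨x, rfl⟩ := h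
    refine ((Set.countable_range fun k : ℤ => 2 * k * Real.pi + x).union
      (Set.countable_range fun k : ℤ => 2 * k * Real.pi - x)).mono fun θ hθ => ?_
    obtain ⟨k, hk | hk⟩ := Real.cos_eq_cos_iff.1 (Eq.symm hθ)
    · exact Or.inl ⟨k, hk.symm⟩
    · exact Or.inr ⟨k, hk.symm⟩
  · push Not at h
    convert Set.countable_empty
    exact Set.eq_empty_of_forall_notMem h

lemma uniformCircle_fst_eq (c : ℝ) : uniformCircle {p | p.1 = c} = 0 := by
  rw [uniformCircle_apply (measurableSet_eq_fun measurable_fst measurable_const)]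
  have : volume ({θ : ℝ | Real.cos θ = c} ∩ Set.Ioc 0 (2 * Real.pi)) = 0 :=
    measure_mono_null Set.inter_subset_left ((countable_setOf_cos_eq c).measure_zero _)
  simp only [Set.mem_ofPred_eq, this, mul_zero]

lemma uniformCircle_half_lt_fst_pos : 0 < uniformCircle {p | 1 / 2 < p.1} := by
  have hpi := Real.pi_pos
  rw [uniformCircle_apply (measurableSet_lt measurable_const measurable_fst)]
  refine ENNReal.mul_pos (ENNReal.inv_ne_zero.2 ENNReal.ofReal_ne_top) (ne_of_gt ?_)
  refine lt_of_lt_of_le ?_ (measure_mono (s := Set.Ioo 0 (Real.pi / 3)) fun θ hθ => ⟨?_, hθ.1, ?_⟩)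
  · simpa using hpi
  · rw [Set.mem_ofPred_eq, Set.mem_ofPred_eq, ← Real.cos_pi_div_three]
    exact Real.cos_lt_cos_of_nonneg_of_le_pi hθ.1.le (by linarith) hθ.2
  · linarith [hθ.2]

lemma nullSingletonClass_map_projection (ν : Measure ℝ) [SFinite ν]
    (hν : ν (Set.Iic 0) = 0) :
    NullSingletonClass ((ν.prod uniformCircle).map (fun q => q.1 * q.2.1)) := by
  refine ⟨fun t => ?_⟩
  have hm : Measurable fun q : ℝ × ℝ × ℝ => q.1 * q.2.1 := by fun_prop
  rw [Measure.map_apply hm (measurableSet_singleton t),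
    Measure.measure_prod_null (hm (measurableSet_singleton t))]
  have hpos : ∀ᵐ r ∂ν, 0 < r := by
    rw [ae_iff]
    simp only [not_lt]
    exact hν
  filter_upwards [hpos] with r hr
  refine measure_mono_null (fun p hp => ?_) (uniformCircle_fst_eq (t / r))
  rw [Set.mem_ofPred_eq, eq_div_iff hr.ne', mul_comm]
  exact hp

section Polar

variable (ν : Measure ℝ) [IsProbabilityMeasure ν]

lemma prod_uniformCircle_real {T : Set (ℝ × ℝ × ℝ)} (hT : MeasurableSet T) :
    (ν.prod uniformCircle).real T = (2 * Real.pi)⁻¹ *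
      ∫ θ in (0 : ℝ)..2 * Real.pi, ν.real {r | (r, Real.cos θ, Real.sin θ) ∈ T} := by
  have hpi := Real.two_pi_pos
  have hmp : Measurable fun p : ℝ × ℝ => ν ((fun r => (r, p)) ⁻¹' T) :=
    measurable_measure_prodMk_right hT
  have hm : Measurable fun θ : ℝ => (Real.cos θ, Real.sin θ) := by fun_prop
  rw [Measure.real, Measure.prod_apply_symm hT, uniformCircle, lintegral_map hmp hm,
    lintegral_smul_measure, smul_eq_mul, ENNReal.toReal_mul, ENNReal.toReal_inv,
    ENNReal.toReal_ofReal hpi.le, intervalIntegral.integral_of_le hpi.le]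
  congr 1
  exact (integral_toReal (hmp.comp hm).aemeasurable
    (Eventually.of_forall fun _ => measure_lt_top _ _)).symm

lemma measurable_polarSection {T : Set (ℝ × ℝ × ℝ)} (hT : MeasurableSet T) :
    Measurable fun θ : ℝ => ν.real {r | (r, Real.cos θ, Real.sin θ) ∈ T} :=
  ((measurable_measure_prodMk_right hT).comp
    (by fun_prop : Measurable fun θ : ℝ => (Real.cos θ, Real.sin θ))).ennreal_toReal

lemma map_rotated_projection (ψ : ℝ) :
    (ν.prod uniformCircle).map (fun q => q.1 * (Real.cos ψ * q.2.1 + Real.sin ψ * q.2.2))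
      = (ν.prod uniformCircle).map (fun q => q.1 * q.2.1) := by
  have hm (ψ : ℝ) : Measurable fun q : ℝ × ℝ × ℝ =>
    q.1 * (Real.cos ψ * q.2.1 + Real.sin ψ * q.2.2) := by fun_prop
  have key (ψ : ℝ) {A : Set ℝ} (hA : MeasurableSet A) : (ν.prod uniformCircle).real
      ((fun q => q.1 * (Real.cos ψ * q.2.1 + Real.sin ψ * q.2.2)) ⁻¹' A)
      = (2 * Real.pi)⁻¹ * ∫ θ in (0 : ℝ)..2 * Real.pi, ν.real {r | r * Real.cos θ ∈ A} := by
    rw [prod_uniformCircle_real ν (hm ψ hA)]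
    congr 1
    have hper : Function.Periodic (fun θ => ν.real {r | r * Real.cos θ ∈ A}) (2 * Real.pi) :=
      fun θ => by simp only [Real.cos_add_two_pi]
    calc _ = ∫ θ in (0 : ℝ)..2 * Real.pi, ν.real {r | r * Real.cos (θ - ψ) ∈ A} := by
          refine intervalIntegral.integral_congr fun θ _ => ?_
          simp only [Set.mem_preimage, Real.cos_sub, mul_comm (Real.cos ψ), mul_comm (Real.sin ψ)]
      _ = _ := by
          rw [intervalIntegral.integral_comp_sub_right
            (fun θ => ν.real {r | r * Real.cos θ ∈ A}), show 2 * Real.pi - ψ =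
              (0 - ψ) + 2 * Real.pi by ring, hper.intervalIntegral_add_eq (0 - ψ) 0, zero_add]
  ext A hA
  have h0 := key 0 hA
  simp only [Real.cos_zero, Real.sin_zero, one_mul, zero_mul, add_zero] at h0
  rw [Measure.map_apply (hm ψ) hA, Measure.map_apply (by fun_prop) hA]
  exact (measureReal_eq_measureReal_iff).1 ((key ψ hA).trans h0.symm)

lemma cdf_map_projection_lt_one (hν : ∀ x, 0 < ν (Set.Ioi x)) (t : ℝ) :
    cdf ((ν.prod uniformCircle).map (fun q => q.1 * q.2.1)) t < 1 := by
  have hm : Measurable fun q : ℝ × ℝ × ℝ => q.1 * q.2.1 := by fun_prop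
  have : IsProbabilityMeasure ((ν.prod uniformCircle).map (fun q => q.1 * q.2.1)) :=
    Measure.isProbabilityMeasure_map hm.aemeasurable
  have hpos : 0 < (ν.prod uniformCircle).map (fun q => q.1 * q.2.1) (Set.Ioi t) := by
    rw [Measure.map_apply hm measurableSet_Ioi]
    refine lt_of_lt_of_le ?_ (measure_mono
      (s := Set.Ioi (2 * |t|) ×ˢ {p : ℝ × ℝ | 1 / 2 < p.1}) fun q hq => ?_)
    · rw [Measure.prod_prod]
      exact ENNReal.mul_pos (hν _).ne' uniformCircle_half_lt_fst_pos.ne'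
    · obtain ⟨h1, h2⟩ := hq
      simp only [Set.mem_Ioi, Set.mem_ofPred_eq] at h1 h2
      have h3 : t < q.1 * q.2.1 := by
        have := le_abs_self t
        have := abs_nonneg t
        nlinarith
      exact h3
  rw [cdf_eq_real, ← Set.compl_Ioi, probReal_compl_eq_one_sub measurableSet_Ioi]
  have := ENNReal.toReal_pos hpos.ne' (measure_ne_top _ _)
  simp only [Measure.real]
  linarith

lemma prod_uniformCircle_real_joint_tail (hν : ν (Set.Iic 0) = 0) {β b : ℝ} (hb : 0 ≤ b)
    (hβ : β ∈ Set.Ioo 0 (Real.pi / 2)) :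
    (ν.prod uniformCircle).real {q | b < q.1 * q.2.1 ∧
        b < q.1 * (Real.cos (2 * β) * q.2.1 + Real.sin (2 * β) * q.2.2)}
      = Real.pi⁻¹ * ∫ φ in (0 : ℝ)..Real.pi / 2 - β,
          ν.real (Set.Ioi (b / Real.cos (β + φ))) := by
  obtain ⟨hβ0, hβ1⟩ := hβ
  have hpi := Real.pi_pos
  have hT : MeasurableSet {q : ℝ × ℝ × ℝ | b < q.1 * q.2.1 ∧
        b < q.1 * (Real.cos (2 * β) * q.2.1 + Real.sin (2 * β) * q.2.2)} :=
    measurableSet_setOfPred.2 (Measurable.and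
      (measurableSet_setOfPred.1 (measurableSet_lt measurable_const (by fun_prop)))
      (measurableSet_setOfPred.1 (measurableSet_lt measurable_const (by fun_prop))))
  have hmeas := measurable_polarSection ν hT
  rw [prod_uniformCircle_real ν hT]
  set H : ℝ → ℝ := fun θ => ν.real {r | b < r * Real.cos θ ∧ b < r * Real.cos (θ - 2 * β)}
    with hH
  have hHeq : (fun θ : ℝ => ν.real {r | (r, Real.cos θ, Real.sin θ) ∈
      {q : ℝ × ℝ × ℝ | b < q.1 * q.2.1 ∧
        b < q.1 * (Real.cos (2 * β) * q.2.1 + Real.sin (2 * β) * q.2.2)}}) = H := by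
    ext θ
    simp only [hH, Set.mem_ofPred_eq, Real.cos_sub, mul_comm (Real.cos (2 * β)),
      mul_comm (Real.sin (2 * β))]
  rw [hHeq] at hmeas ⊢
  have hper : Function.Periodic H (2 * Real.pi) := fun θ => by
    simp only [hH, Real.cos_add_two_pi, add_sub_right_comm θ (2 * Real.pi)]
  have hint (x y : ℝ) : IntervalIntegrable (fun φ => H (β + φ)) volume x y := by
    refine (intervalIntegrable_const (c := (1 : ℝ))).mono_fun
      (hmeas.comp (by fun_prop)).aestronglyMeasurable (Eventually.of_forall fun φ => ?_)
    simp only [hH, Real.norm_of_nonneg measureReal_nonneg, norm_one]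
    exact measureReal_le_one
  have hshift : ∫ θ in (0 : ℝ)..2 * Real.pi, H θ = ∫ φ in -Real.pi..Real.pi, H (β + φ) := by
    rw [intervalIntegral.integral_comp_add_left H,
      show β + Real.pi = (β + -Real.pi) + 2 * Real.pi by ring,
      hper.intervalIntegral_add_eq (β + -Real.pi) 0, zero_add]
  have heven (φ : ℝ) : H (β + -φ) = H (β + φ) := by
    have e1 : Real.cos (β + -φ) = Real.cos (β + φ - 2 * β) := by
      rw [← Real.cos_neg]; congr 1; ring
    have e2 : Real.cos (β + -φ - 2 * β) = Real.cos (β + φ) := by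
      rw [← Real.cos_neg]; congr 1; ring
    simp only [hH, e1, e2, and_comm]
  have hhalf : ∫ φ in -Real.pi..(0 : ℝ), H (β + φ) = ∫ φ in (0 : ℝ)..Real.pi, H (β + φ) := by
    rw [← neg_zero, ← intervalIntegral.integral_comp_neg (fun φ => H (β + φ)), neg_zero]
    simp only [heven]
  have hpos : ∀ᵐ r ∂ν, 0 < r := by
    rw [ae_iff]
    simp only [not_lt]
    exact hν
  have hinner : ∫ φ in (0 : ℝ)..Real.pi / 2 - β, H (β + φ)
      = ∫ φ in (0 : ℝ)..Real.pi / 2 - β, ν.real (Set.Ioi (b / Real.cos (β + φ))) := by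
    rw [intervalIntegral.integral_of_le (by linarith), intervalIntegral.integral_of_le (by linarith),
      integral_Ioc_eq_integral_Ioo, integral_Ioc_eq_integral_Ioo]
    refine setIntegral_congr_fun measurableSet_Ioo fun φ hφ => ?_
    obtain ⟨hφ0, hφ1⟩ := hφ
    have hc : 0 < Real.cos (β + φ) := Real.cos_pos_of_mem_Ioo ⟨by linarith, by linarith⟩
    have hle : Real.cos (β + φ) ≤ Real.cos (β + φ - 2 * β) := by
      rw [← Real.cos_neg (β + φ - 2 * β)]
      by_cases h : φ ≤ β
      · exact Real.cos_le_cos_of_nonneg_of_le_pi (by linarith) (by linarith) (by linarith)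
      · rw [Real.cos_neg]
        exact Real.cos_le_cos_of_nonneg_of_le_pi (by linarith) (by linarith) (by linarith)
    refine measureReal_congr ?_
    filter_upwards [hpos] with r hr
    refine propext ?_
    change (b < r * _ ∧ b < r * _) ↔ b / Real.cos (β + φ) < r
    rw [div_lt_iff₀ hc]
    exact ⟨fun h => h.1, fun h => ⟨h, h.trans_le (by gcongr)⟩⟩
  have houter : ∫ φ in Real.pi / 2 - β..Real.pi, H (β + φ) = 0 := by
    refine intervalIntegral.integral_zero_ae (Eventually.of_forall fun φ hφ => ?_)
    rw [Set.uIoc_of_le (by linarith)] at hφ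
    obtain ⟨hφ0, hφ1⟩ := hφ
    have hc : Real.cos (β + φ) ≤ 0 :=
      Real.cos_nonpos_of_pi_div_two_le_of_le (by linarith) (by linarith)
    rw [hH]
    simp only
    rw [measureReal_eq_zero_iff]
    refine measure_mono_null (fun r hr => ?_) hν
    by_contra hr0
    have : 0 < r := not_le.1 hr0
    have := hr.1
    nlinarith
  rw [hshift, ← intervalIntegral.integral_add_adjacent_intervals (hint _ 0) (hint 0 _), hhalf,
    ← intervalIntegral.integral_add_adjacent_intervals (hint 0 (Real.pi / 2 - β)) (hint _ Real.pi),
    hinner, houter]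
  field_simp
  ring

end Polar

lemma copula_constant_eq {β : ℝ} (hβ : β ∈ Set.Ioo 0 (Real.pi / 2)) :
    (1 / Real.cos β) ^ 2 * (1 - Real.cos (2 * β) ^ 2) ^ ((3 : ℝ) / 2) /
      (2 * Real.pi * (1 - Real.cos (2 * β)) ^ 2) = Real.pi⁻¹ * (Real.cos β / Real.sin β) := by
  obtain ⟨hβ0, hβ1⟩ := hβ
  have hc : 0 < Real.cos β := Real.cos_pos_of_mem_Ioo ⟨by linarith, by linarith⟩
  have hs : 0 < Real.sin β := Real.sin_pos_of_pos_of_lt_pi hβ0 (by linarith)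
  have hpi := Real.pi_pos
  have h1 : 1 - Real.cos (2 * β) ^ 2 = (2 * Real.sin β * Real.cos β) ^ 2 := by
    rw [← Real.sin_two_mul, ← Real.sin_sq]
  have h2 : 1 - Real.cos (2 * β) = 2 * Real.sin β ^ 2 := by
    rw [Real.cos_two_mul, Real.sin_sq]; ring
  have h3 : ((2 * Real.sin β * Real.cos β) ^ 2) ^ ((3 : ℝ) / 2)
      = (2 * Real.sin β * Real.cos β) ^ 3 := by
    rw [← Real.rpow_natCast, ← Real.rpow_natCast, ← Real.rpow_mul (by positivity)]
    norm_num
  rw [h1, h2, h3]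
  field_simp

lemma gumbelTail_of_cdf {ν : Measure ℝ} [IsProbabilityMeasure ν] {F w : ℝ → ℝ}
    (hF : F = cdf ν) (hF0 : F 0 = 0) (hFlt : ∀ x > (0 : ℝ), F x < 1) (hw : ∀ u, 0 < w u)
    (hGumbel : ∀ x : ℝ,
      Tendsto (fun u => (1 - F (u + x / w u)) / (1 - F u)) atTop (nhds (Real.exp (-x)))) :
    GumbelTail (fun t => 1 - F t) w := by
  subst hF
  have hzero (x : ℝ) (hx : x ≤ 0) : cdf ν x = 0 :=
    le_antisymm ((monotone_cdf ν hx).trans hF0.le) (cdf_nonneg ν x)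
  refine ⟨fun s t hst => sub_le_sub_left (monotone_cdf ν hst) 1, fun x => ?_, fun x hx => ?_,
    ?_, hw, hGumbel⟩
  · rcases le_or_gt x 0 with hx | hx
    · simp [hzero x hx]
    · exact sub_pos.2 (hFlt x hx)
  · simp [hzero x hx]
  · simpa using (tendsto_cdf_atTop ν).const_sub 1

/-- If `F` is in the Gumbel max-domain of attraction with scaling function `w`, then as
`u → ∞`, `S̃_u(1,1) = (1+o(1)) · [α_ρ²(1-ρ²)^(3/2)/(2π(1-ρ)²)] · (1-F(b_*(u)))/(b_*(u)w(b_*(u)))`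
where `b_*(u) = α_ρ Q⁻¹(1-1/u)`. -/
theorem Stilde_asymptotic_expansion
    {Ω : Type*} [MeasurableSpace Ω] (μ : Measure Ω) [IsProbabilityMeasure μ]
    (R U₁ U₂ : Ω → ℝ) (ρ : ℝ) (hρ : ρ ∈ Set.Ioo (-1 : ℝ) 1)
    (hRmeas : Measurable R) (hUmeas : Measurable fun ω => (U₁ ω, U₂ ω))
    (hIndep : IndepFun R (fun ω => (U₁ ω, U₂ ω)) μ)
    (hUnif : Measure.map (fun ω => (U₁ ω, U₂ ω)) μ = uniformCircle)
    (X₁ X₂ : Ω → ℝ)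
    (hX₁ : X₁ = fun ω => R ω * U₁ ω)
    (hX₂ : X₂ = fun ω => R ω * (ρ * U₁ ω + Real.sqrt (1 - ρ ^ 2) * U₂ ω))
    -- `F` is the distribution function of the positive random radius `R`
    (F : ℝ → ℝ) (hF : F = fun t => (μ {ω | R ω ≤ t}).toReal)
    (hF0 : F 0 = 0) (hFlt : ∀ x > (0 : ℝ), F x < 1)
    -- `Q` is the distribution function of `X₁`
    (Q : ℝ → ℝ) (hQ : Q = fun t => (μ {ω | X₁ ω ≤ t}).toReal)
    -- `F` is in the Gumbel max-domain of attraction with positive scaling function `w`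
    (w : ℝ → ℝ) (hw : ∀ u, 0 < w u)
    (hGumbel : ∀ x : ℝ,
      Tendsto (fun u => (1 - F (u + x / w u)) / (1 - F u)) atTop (nhds (Real.exp (-x))))
    -- the joint survival function `S̃_u(x,y)`
    (Stilde : ℝ → ℝ → ℝ → ℝ)
    (hStilde : ∀ u x y,
      Stilde u x y = (μ {ω | 1 - x / u < Q (X₁ ω) ∧ 1 - y / u < Q (X₂ ω)}).toReal)
    (αρ : ℝ) (hαρ : αρ = Real.sqrt (2 / (1 + ρ)))
    -- `Q⁻¹` is the generalized inverse of `Q`, and `b_*(u) = α_ρ Q⁻¹(1 - 1/u)`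
    (Qinv : ℝ → ℝ) (hQinv : Qinv = fun p => sInf {t : ℝ | p ≤ Q t})
    (bstar : ℝ → ℝ) (hbstar : bstar = fun u => αρ * Qinv (1 - 1 / u)) :
    Tendsto
      (fun u => Stilde u 1 1 /
        (αρ ^ 2 * (1 - ρ ^ 2) ^ ((3 : ℝ) / 2) / (2 * Real.pi * (1 - ρ) ^ 2) *
          ((1 - F (bstar u)) / (bstar u * w (bstar u)))))
      atTop (nhds 1) := by
  have hU : Measurable fun ω => (R ω, (U₁ ω, U₂ ω)) := hRmeas.prodMk hUmeas
  have hmX₁ : Measurable fun q : ℝ × ℝ × ℝ => q.1 * q.2.1 := by fun_prop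
  set β := Real.arccos ρ / 2 with hβdef
  have hβ : β ∈ Set.Ioo 0 (Real.pi / 2) :=
    ⟨half_pos (Real.arccos_pos.2 hρ.2), by
      have := Real.arccos_lt_pi.2 hρ.1
      rw [hβdef]
      linarith⟩
  have h2β : 2 * β = Real.arccos ρ := by rw [hβdef]; ring
  have hcos2 : Real.cos (2 * β) = ρ := by rw [h2β, Real.cos_arccos hρ.1.le hρ.2.le]
  have hsin2 : Real.sin (2 * β) = Real.sqrt (1 - ρ ^ 2) := by rw [h2β, Real.sin_arccos]
  have hc : 0 < Real.cos β := Real.cos_pos_of_mem_Ioo ⟨by linarith [hβ.1, Real.pi_pos], hβ.2⟩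
  have hs : 0 < Real.sin β :=
    Real.sin_pos_of_pos_of_lt_pi hβ.1 (by linarith [hβ.2, Real.pi_pos])
  have hα : αρ = 1 / Real.cos β := by
    have h : 1 + ρ = 2 * Real.cos β ^ 2 := by rw [← hcos2, Real.cos_two_mul]; ring
    rw [hαρ, h, show 2 / (2 * Real.cos β ^ 2) = (1 / Real.cos β) ^ 2 by field_simp,
      Real.sqrt_sq (by positivity)]
  -- the laws of `R`, of `(R, U)` and of the two coordinates
  set ν := μ.map R with hν
  have : IsProbabilityMeasure ν := Measure.isProbabilityMeasure_map hRmeas.aemeasurable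
  have hjoint : μ.map (fun ω => (R ω, (U₁ ω, U₂ ω))) = ν.prod uniformCircle := by
    rw [(indepFun_iff_map_prod_eq_prod_map_map hRmeas.aemeasurable hUmeas.aemeasurable).1 hIndep,
      hUnif]
  have hFcdf : F = cdf ν := by
    ext t
    rw [hF, cdf_eq_real, hν, map_measureReal_apply hRmeas measurableSet_Iic]
    rfl
  have hG : GumbelTail (fun t => 1 - F t) w := gumbelTail_of_cdf hFcdf hF0 hFlt hw hGumbel
  have htail (t : ℝ) : ν.real (Set.Ioi t) = 1 - F t := by
    rw [hFcdf, cdf_eq_real, ← Set.compl_Iic, probReal_compl_eq_one_sub measurableSet_Iic]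
  have hν0 : ν (Set.Iic 0) = 0 := by
    rw [← measureReal_eq_zero_iff, ← cdf_eq_real, ← hFcdf, hF0]
  have hνpos (x : ℝ) : 0 < ν (Set.Ioi x) := by
    have h := hG.pos x
    simp only [← htail] at h
    exact (ENNReal.toReal_pos_iff.1 h).1
  set κ := (ν.prod uniformCircle).map (fun q => q.1 * q.2.1) with hκ
  have : IsProbabilityMeasure κ := Measure.isProbabilityMeasure_map hmX₁.aemeasurable
  have : NullSingletonClass κ := nullSingletonClass_map_projection ν hν0
  have hmeas₁ : Measurable X₁ := hX₁ ▸ hmX₁.comp hU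
  have hmeas₂ : Measurable X₂ := by
    rw [hX₂]
    exact (by fun_prop : Measurable fun q : ℝ × ℝ × ℝ =>
      q.1 * (ρ * q.2.1 + Real.sqrt (1 - ρ ^ 2) * q.2.2)).comp hU
  have hlaw₁ : μ.map X₁ = κ := by
    rw [hκ, ← hjoint, Measure.map_map hmX₁ hU, hX₁]
    rfl
  have hlaw₂ : μ.map X₂ = κ := by
    rw [hκ, ← map_rotated_projection ν (2 * β), hcos2, hsin2, ← hjoint,
      Measure.map_map (by fun_prop) hU, hX₂]
    rfl
  have hQcdf : Q = cdf κ := by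
    ext t
    rw [hQ, cdf_eq_real, ← hlaw₁, map_measureReal_apply hmeas₁ measurableSet_Iic]
    rfl
  have hQinv_top : Tendsto (fun u : ℝ => Qinv (1 - 1 / u)) atTop atTop := by
    rw [hQinv, hQcdf]
    exact tendsto_sInf_cdf_atTop κ (cdf_map_projection_lt_one ν hνpos)
  have hbstar_top : Tendsto bstar atTop atTop := by
    rw [hbstar]
    exact hQinv_top.const_mul_atTop (by rw [hα]; positivity)
  have hS : ∀ᶠ u in atTop, Stilde u 1 1 = Real.pi⁻¹ * ∫ φ in (0 : ℝ)..Real.pi / 2 - β,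
      (1 - F (bstar u * Real.cos β / Real.cos (β + φ))) := by
    filter_upwards [hQinv_top.eventually_ge_atTop 0, eventually_gt_atTop 1] with u hb hu
    have hp0 : 0 < 1 - 1 / u := sub_pos.2 ((div_lt_one (by linarith)).2 hu)
    have hp1 : 1 - 1 / u < 1 := sub_lt_self _ (by positivity)
    have hae := cdf_superlevel_ae_eq_Ioi κ hp0 hp1
    have h₁ : ∀ᵐ ω ∂μ, 1 - 1 / u < Q (X₁ ω) ↔ Qinv (1 - 1 / u) < X₁ ω := by
      rw [hQinv, hQcdf]
      rw [← hlaw₁] at hae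
      filter_upwards [ae_of_ae_map hmeas₁.aemeasurable hae] with ω hω
      rw [hlaw₁] at hω
      exact iff_of_eq hω
    have h₂ : ∀ᵐ ω ∂μ, 1 - 1 / u < Q (X₂ ω) ↔ Qinv (1 - 1 / u) < X₂ ω := by
      rw [hQinv, hQcdf]
      rw [← hlaw₂] at hae
      filter_upwards [ae_of_ae_map hmeas₂.aemeasurable hae] with ω hω
      rw [hlaw₂] at hω
      exact iff_of_eq hω
    have hevent : Stilde u 1 1 =
        μ.real {ω | Qinv (1 - 1 / u) < X₁ ω ∧ Qinv (1 - 1 / u) < X₂ ω} := by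
      rw [hStilde]
      refine measureReal_congr ?_
      filter_upwards [h₁, h₂] with ω hω₁ hω₂
      exact propext (and_congr hω₁ hω₂)
    have hb' : bstar u * Real.cos β = Qinv (1 - 1 / u) := by
      rw [hbstar, hα]
      field_simp
    have hform := prod_uniformCircle_real_joint_tail ν hν0 hb hβ
    simp only [htail] at hform
    rw [hevent, hb', ← hform, ← hjoint, map_measureReal_apply hU, hX₁, hX₂, hcos2, hsin2]
    · rfl
    · exact measurableSet_setOfPred.2 (Measurable.and
        (measurableSet_setOfPred.1 (measurableSet_lt measurable_const (by fun_prop)))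
        (measurableSet_setOfPred.1 (measurableSet_lt measurable_const (by fun_prop))))
  have hlim := (hG.tendsto_integral_div hβ).comp hbstar_top
  have hcot : Real.cos β / Real.sin β ≠ 0 := (div_pos hc hs).ne'
  have hconst := copula_constant_eq hβ
  rw [hcos2, ← hα] at hconst
  rw [hconst]
  have hone := hlim.div_const (Real.cos β / Real.sin β)
  rw [div_self hcot] at hone
  refine hone.congr' ?_
  filter_upwards [hS] with u hu
  rw [hu, mul_assoc, mul_div_mul_left _ _ (inv_ne_zero Real.pi_ne_zero)]
  simp only [Function.comp]
  rw [div_div, mul_comm (_ / _) (Real.cos β / Real.sin β)]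
end

section
/- Let Σ ∈ ℝ^{3×3} be a positive definite correlation matrix with off-diagonal entries ρ₁₂, ρ₁₃, ρ₂₃ ∈ (−1,1), let ρ_min := min(ρ₁₂, ρ₁₃, ρ₂₃), and let α := min{ xᵀ Σ^{−1} x : x ∈ ℝ³, x_i ≥ 1 for i = 1,2,3 }. If 1 + 2ρ_min − ρ₁₂ − ρ₁₃ − ρ₂₃ > 0, then α = 1ᵀ Σ^{−1} 1 = [3 − 2(ρ₁₂+ρ₁₃+ρ₂₃) − ρ₁₂² − ρ₁₃² − ρ₂₃² + 2(ρ₁₂ρ₁₃ + ρ₁₂ρ₂₃ + ρ₁₃ρ₂₃)] / [1 + 2ρ₁₂ρ₁₃ρ₂₃ − ρ₁₂² − ρ₁₃² − ρ₂₃²], where 1 = (1,1,1)ᵀ. -/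
open Matrix

/-- If `M` is positive semidefinite and `M a ≥ 0`, then `a` minimizes `xᵀ M x` over `x ≥ a`. -/
theorem Matrix.PosSemidef.dotProduct_mulVec_le_of_le {n : Type*} [Fintype n]
    {M : Matrix n n ℝ} (hM : M.PosSemidef) {a x : n → ℝ} (ha : 0 ≤ M *ᵥ a) (hax : a ≤ x) :
    a ⬝ᵥ M *ᵥ a ≤ x ⬝ᵥ M *ᵥ x := by
  obtain ⟨d, rfl⟩ : ∃ d, x = a + d := ⟨x - a, by simp⟩
  have hd : 0 ≤ d := by simpa using hax
  have hquad : 0 ≤ d ⬝ᵥ M *ᵥ d := by simpa using hM.dotProduct_mulVec_nonneg d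
  have hcross : 0 ≤ d ⬝ᵥ M *ᵥ a := dotProduct_nonneg_of_nonneg hd ha
  have hsymm : a ⬝ᵥ M *ᵥ d = d ⬝ᵥ M *ᵥ a := by
    have hT : Mᵀ = M := by simpa [conjTranspose_eq_transpose_of_trivial] using hM.isHermitian.eq
    rw [dotProduct_mulVec, ← mulVec_transpose, hT, dotProduct_comm]
  rw [mulVec_add, dotProduct_add, add_dotProduct, add_dotProduct, hsymm]
  linarith

/-- Lemma 1 (i): for a positive definite `3×3` correlation matrix `Σ` with off-diagonal
entries `ρ₁₂, ρ₁₃, ρ₂₃ ∈ (-1,1)`, if `1 + 2ρ_min - ρ₁₂ - ρ₁₃ - ρ₂₃ > 0`, then the minimum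
`α` of `xᵀ Σ⁻¹ x` over `{x : xᵢ ≥ 1}` equals `1ᵀ Σ⁻¹ 1`, which is given by the explicit
rational expression in the correlations. -/
theorem quadratic_min_three_dim_interior
    (ρ₁₂ ρ₁₃ ρ₂₃ : ℝ)
    (h₁₂ : ρ₁₂ ∈ Set.Ioo (-1 : ℝ) 1) (h₁₃ : ρ₁₃ ∈ Set.Ioo (-1 : ℝ) 1)
    (h₂₃ : ρ₂₃ ∈ Set.Ioo (-1 : ℝ) 1)
    (Sig : Matrix (Fin 3) (Fin 3) ℝ)
    (hSig : Sig = !![1, ρ₁₂, ρ₁₃; ρ₁₂, 1, ρ₂₃; ρ₁₃, ρ₂₃, 1])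
    (hpos : Sig.PosDef)
    (ρmin : ℝ) (hρmin : ρmin = min ρ₁₂ (min ρ₁₃ ρ₂₃))
    (α : ℝ)
    (hα : IsLeast {v : ℝ | ∃ x : Fin 3 → ℝ, (∀ i, 1 ≤ x i) ∧ v = x ⬝ᵥ Sig⁻¹.mulVec x} α)
    (hcond : 0 < 1 + 2 * ρmin - ρ₁₂ - ρ₁₃ - ρ₂₃) :
    α = (fun _ : Fin 3 => (1 : ℝ)) ⬝ᵥ Sig⁻¹.mulVec (fun _ : Fin 3 => (1 : ℝ)) ∧
    α = (3 - 2 * (ρ₁₂ + ρ₁₃ + ρ₂₃) - ρ₁₂ ^ 2 - ρ₁₃ ^ 2 - ρ₂₃ ^ 2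
          + 2 * (ρ₁₂ * ρ₁₃ + ρ₁₂ * ρ₂₃ + ρ₁₃ * ρ₂₃)) /
        (1 + 2 * ρ₁₂ * ρ₁₃ * ρ₂₃ - ρ₁₂ ^ 2 - ρ₁₃ ^ 2 - ρ₂₃ ^ 2) := by
  have hdet : Sig.det = 1 + 2 * ρ₁₂ * ρ₁₃ * ρ₂₃ - ρ₁₂ ^ 2 - ρ₁₃ ^ 2 - ρ₂₃ ^ 2 := by
    rw [hSig, det_fin_three]
    simp
    ring
  have hD := hpos.det_pos
  rw [← hdet]
  have hunit : IsUnit Sig.det := hD.ne'.isUnit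
  set w : Fin 3 → ℝ := Sig.det⁻¹ • ![(1 - ρ₂₃) * (1 + ρ₂₃ - ρ₁₂ - ρ₁₃),
    (1 - ρ₁₃) * (1 + ρ₁₃ - ρ₁₂ - ρ₂₃), (1 - ρ₁₂) * (1 + ρ₁₂ - ρ₁₃ - ρ₂₃)] with hw
  have hSw : Sig *ᵥ w = fun _ => 1 := by
    rw [hw, mulVec_smul, inv_smul_eq_iff₀ hD.ne', hdet, hSig]
    ext i
    fin_cases i <;> simp [mulVec, dotProduct, Fin.sum_univ_three] <;> ring
  have hinv : Sig⁻¹ *ᵥ (fun _ => 1) = w := by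
    rw [← hSw, mulVec_mulVec, nonsing_inv_mul _ hunit, one_mulVec]
  have hm₁₂ : ρmin ≤ ρ₁₂ := by simp [hρmin]
  have hm₁₃ : ρmin ≤ ρ₁₃ := by simp [hρmin]
  have hm₂₃ : ρmin ≤ ρ₂₃ := by simp [hρmin]
  have hw0 : 0 ≤ w := by
    refine smul_nonneg (inv_nonneg.2 hD.le) fun i => ?_
    fin_cases i
    · exact mul_nonneg (by linarith [h₂₃.2]) (by linarith)
    · exact mul_nonneg (by linarith [h₁₃.2]) (by linarith)
    · exact mul_nonneg (by linarith [h₁₂.2]) (by linarith)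
  have hα1 : α = (fun _ : Fin 3 => (1 : ℝ)) ⬝ᵥ Sig⁻¹ *ᵥ fun _ => 1 := by
    refine hα.unique ⟨⟨_, fun _ => le_rfl, rfl⟩, ?_⟩
    rintro _ ⟨x, hx, rfl⟩
    exact hpos.inv.posSemidef.dotProduct_mulVec_le_of_le (hinv ▸ hw0) hx
  refine ⟨hα1, ?_⟩
  rw [hα1, hinv, hw, dotProduct_smul, smul_eq_mul, inv_mul_eq_div]
  congr 1
  simp [dotProduct, Fin.sum_univ_three]
  ring
end

section
/- Let Σ ∈ ℝ^{3×3} be a positive definite correlation matrix with off-diagonal entries ρ₁₂, ρ₁₃, ρ₂₃ ∈ (−1,1), let ρ_min := min(ρ₁₂, ρ₁₃, ρ₂₃), and let α := min{ xᵀ Σ^{−1} x : x ∈ ℝ³, x_i ≥ 1 for i = 1,2,3 }. If 1 + 2ρ_min − ρ₁₂ − ρ₁₃ − ρ₂₃ ≤ 0, then there exists a unique index pair {i,j} ⊂ {1,2,3} such that ρ_min = ρ_{ij} and ρ_{ij} is strictly smaller than the other two off-diagonal correlations, and moreover α = 2/(1 + ρ_{ij}). -/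
open Matrix

/-- KKT conditions for minimizing `xᵀ M⁻¹ x` over `{x : xᵢ ≥ 1}`: a nonnegative multiplier `u`
with `M u ≥ 1`, complementary to the constraints, certifies that the minimum is `∑ uᵢ`. -/
theorem Matrix.PosDef.isLeast_inv_quadratic {n : Type*} [Fintype n] [DecidableEq n]
    {M : Matrix n n ℝ} (hM : M.PosDef) {u : n → ℝ} (hu : ∀ i, 0 ≤ u i)
    (hMu : ∀ i, 1 ≤ (M *ᵥ u) i) (huMu : u ⬝ᵥ M *ᵥ u = ∑ i, u i) :
    IsLeast {v : ℝ | ∃ x : n → ℝ, (∀ i, 1 ≤ x i) ∧ v = x ⬝ᵥ M⁻¹ *ᵥ x} (∑ i, u i) := by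
  have hdet : IsUnit M.det := hM.det_pos.ne'.isUnit
  have hsymm : Mᵀ = M := by simpa using hM.isHermitian.eq
  have hcomm (y z : n → ℝ) : y ⬝ᵥ M *ᵥ z = z ⬝ᵥ M *ᵥ y := by
    rw [dotProduct_mulVec, ← mulVec_transpose, hsymm, dotProduct_comm]
  constructor
  · refine ⟨M *ᵥ u, hMu, ?_⟩
    rw [mulVec_mulVec, nonsing_inv_mul M hdet, one_mulVec, dotProduct_comm, huMu]
  · rintro v ⟨x, hx, rfl⟩
    set y := M⁻¹ *ᵥ x with hy
    have hMy : M *ᵥ y = x := by rw [hy, mulVec_mulVec, mul_nonsing_inv M hdet, one_mulVec]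
    have hnonneg : 0 ≤ (y - u) ⬝ᵥ M *ᵥ (y - u) := by
      simpa using hM.posSemidef.dotProduct_mulVec_nonneg (y - u)
    have hux : ∑ i, u i ≤ u ⬝ᵥ x :=
      Finset.sum_le_sum fun i _ => le_mul_of_one_le_right (hu i) (hx i)
    rw [mulVec_sub, sub_dotProduct, dotProduct_sub, dotProduct_sub, hcomm y u, huMu, hMy,
      dotProduct_comm y x] at hnonneg
    linarith

/-- Lemma 1 (ii): for a positive definite `3×3` correlation matrix `Σ` with off-diagonal
entries `ρ₁₂, ρ₁₃, ρ₂₃ ∈ (-1,1)`, if `1 + 2ρ_min - ρ₁₂ - ρ₁₃ - ρ₂₃ ≤ 0`, then there is a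
unique index pair whose correlation equals `ρ_min` and is strictly smaller than the other
two correlations, and the minimum `α` of `xᵀ Σ⁻¹ x` over `{x : xᵢ ≥ 1}` equals
`2/(1 + ρ_min)`. (The three pairs `{1,2}, {1,3}, {2,3}` are encoded by `Fin 3` via the
vector `![ρ₁₂, ρ₁₃, ρ₂₃]`.) -/
theorem quadratic_min_three_dim_boundary
    (ρ₁₂ ρ₁₃ ρ₂₃ : ℝ)
    (h₁₂ : ρ₁₂ ∈ Set.Ioo (-1 : ℝ) 1) (h₁₃ : ρ₁₃ ∈ Set.Ioo (-1 : ℝ) 1)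
    (h₂₃ : ρ₂₃ ∈ Set.Ioo (-1 : ℝ) 1)
    (Sig : Matrix (Fin 3) (Fin 3) ℝ)
    (hSig : Sig = !![1, ρ₁₂, ρ₁₃; ρ₁₂, 1, ρ₂₃; ρ₁₃, ρ₂₃, 1])
    (hpos : Sig.PosDef)
    (ρmin : ℝ) (hρmin : ρmin = min ρ₁₂ (min ρ₁₃ ρ₂₃))
    (α : ℝ)
    (hα : IsLeast {v : ℝ | ∃ x : Fin 3 → ℝ, (∀ i, 1 ≤ x i) ∧ v = x ⬝ᵥ Sig⁻¹.mulVec x} α)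
    (hcond : 1 + 2 * ρmin - ρ₁₂ - ρ₁₃ - ρ₂₃ ≤ 0) :
    (∃! t : Fin 3, ![ρ₁₂, ρ₁₃, ρ₂₃] t = ρmin ∧
        ∀ s : Fin 3, s ≠ t → ![ρ₁₂, ρ₁₃, ρ₂₃] t < ![ρ₁₂, ρ₁₃, ρ₂₃] s) ∧
    α = 2 / (1 + ρmin) := by
  obtain ⟨h₁₂l, h₁₂u⟩ := h₁₂
  obtain ⟨h₁₃l, h₁₃u⟩ := h₁₃
  obtain ⟨h₂₃l, h₂₃u⟩ := h₂₃
  have hcases : (ρmin = ρ₁₂ ∧ ρ₁₂ < ρ₁₃ ∧ ρ₁₂ < ρ₂₃) ∨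
      (ρmin = ρ₁₃ ∧ ρ₁₃ < ρ₁₂ ∧ ρ₁₃ < ρ₂₃) ∨ (ρmin = ρ₂₃ ∧ ρ₂₃ < ρ₁₂ ∧ ρ₂₃ < ρ₁₃) := by
    clear hα hpos hSig
    grind
  have hmin_pos : 0 < 1 + ρmin := by
    clear hα hpos hSig
    grind
  have hinv : 0 ≤ (1 + ρmin)⁻¹ := (inv_pos.2 hmin_pos).le
  have hmul : (1 + ρmin)⁻¹ * (1 + ρmin) = 1 := inv_mul_cancel₀ hmin_pos.ne'
  have hsum : 1 ≤ (1 + ρmin)⁻¹ * (ρ₁₂ + ρ₁₃ + ρ₂₃ - ρmin) := by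
    rw [inv_mul_eq_div, one_le_div hmin_pos]
    linarith
  set s := (1 + ρmin)⁻¹ with hs
  have hmin (u : Fin 3 → ℝ) (hu : ∀ i, 0 ≤ u i) (hMu : ∀ i, 1 ≤ (Sig *ᵥ u) i)
      (huMu : u ⬝ᵥ Sig *ᵥ u = ∑ i, u i) (hsu : ∑ i, u i = 2 * s) : α = 2 / (1 + ρmin) := by
    rw [div_eq_mul_inv, ← hs, ← hsu]
    exact hα.unique (hpos.isLeast_inv_quadratic hu hMu huMu)
  rcases hcases with ⟨h, h₁, h₂⟩ | ⟨h, h₁, h₂⟩ | ⟨h, h₁, h₂⟩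
  · constructor
    · refine ⟨0, ⟨by simp [h], by simp [Fin.forall_fin_succ, h₁, h₂]⟩, fun t ht => ?_⟩
      by_contra hne
      exact (ht.2 0 (Ne.symm hne)).ne (ht.1.trans h)
    · rw [h] at hmul hsum
      apply hmin ![s, s, 0]
      · simp [Fin.forall_fin_succ, hinv]
      · simp only [hSig, Fin.forall_fin_succ, mulVec, dotProduct, Fin.sum_univ_three]
        simp
        refine ⟨?_, ?_, ?_⟩ <;> linarith
      · simp [hSig, mulVec, dotProduct, Fin.sum_univ_three]
        linear_combination 2 * s * hmul
      · simp [Fin.sum_univ_three]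
        ring
  · constructor
    · refine ⟨1, ⟨by simp [h], by simp [Fin.forall_fin_succ, h₁, h₂]⟩, fun t ht => ?_⟩
      by_contra hne
      exact (ht.2 1 (Ne.symm hne)).ne (ht.1.trans h)
    · rw [h] at hmul hsum
      apply hmin ![s, 0, s]
      · simp [Fin.forall_fin_succ, hinv]
      · simp only [hSig, Fin.forall_fin_succ, mulVec, dotProduct, Fin.sum_univ_three]
        simp
        refine ⟨?_, ?_, ?_⟩ <;> linarith
      · simp [hSig, mulVec, dotProduct, Fin.sum_univ_three]
        linear_combination 2 * s * hmul
      · simp [Fin.sum_univ_three]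
        ring
  · constructor
    · refine ⟨2, ⟨by simp [h], by simp [Fin.forall_fin_succ, h₁, h₂]⟩, fun t ht => ?_⟩
      by_contra hne
      exact (ht.2 2 (Ne.symm hne)).ne (ht.1.trans h)
    · rw [h] at hmul hsum
      apply hmin ![0, s, s]
      · simp [Fin.forall_fin_succ, hinv]
      · simp only [hSig, Fin.forall_fin_succ, mulVec, dotProduct, Fin.sum_univ_three]
        simp
        refine ⟨?_, ?_, ?_⟩ <;> linarith
      · simp [hSig, mulVec, dotProduct, Fin.sum_univ_three]
        linear_combination 2 * s * hmul
      · simp [Fin.sum_univ_three]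
        ring
end

section
/- Suppose R has the unit Gumbel distribution Λ(x) = exp(−exp(−x)) restricted to being the distribution function of the positive random radius (so F is in the Gumbel max-domain of attraction with scaling function w ≡ 1). Then the function u ↦ S̃_u(1,1) is regularly varying at infinity with index −((1+ρ)/2)^{−1/2}. -/
open MeasureTheory ProbabilityTheory Filter Real

section Laplace

variable {α : Type*} [MeasurableSpace α] {ν : Measure α} [IsFiniteMeasure ν] {Y : α → ℝ}

lemma integrable_exp_neg_mul (hY : Measurable Y) (hY0 : ∀ᵐ x ∂ν, 0 ≤ Y x) {t : ℝ} (ht : 0 ≤ t) :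
    Integrable (fun x => exp (-(t * Y x))) ν := by
  refine Integrable.of_bound (C := 1) (by fun_prop) ?_
  filter_upwards [hY0] with x hx
  rw [Real.norm_eq_abs, abs_of_pos (exp_pos _), exp_le_one_iff]
  have := mul_nonneg ht hx
  linarith

/-- A Laplace transform decays more slowly than any exponential if `0` is in the support. -/
lemma exists_exp_le_laplace (hY : Measurable Y) (hY0 : ∀ᵐ x ∂ν, 0 ≤ Y x)
    (hpos : ∀ ε > 0, ν {x | Y x < ε} ≠ 0) {ε : ℝ} (hε : 0 < ε) :
    ∃ p > 0, ∀ t ≥ 0, p * exp (-(t * ε)) ≤ ∫ x, exp (-(t * Y x)) ∂ν := by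
  refine ⟨ν.real {x | Y x < ε}, ENNReal.toReal_pos (hpos ε hε) (measure_ne_top _ _), ?_⟩
  intro t ht
  have hms : MeasurableSet {x | Y x < ε} := measurableSet_lt hY measurable_const
  rw [← smul_eq_mul, ← integral_indicator_const _ hms]
  refine integral_mono ((integrable_const _).indicator hms) (integrable_exp_neg_mul hY hY0 ht) ?_
  intro x
  by_cases hx : x ∈ {x | Y x < ε}
  · simp only [Set.indicator_of_mem hx]
    have := mul_le_mul_of_nonneg_left (le_of_lt hx) ht
    exact exp_le_exp.2 (by linarith)
  · simp only [Set.indicator_of_notMem hx]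
    positivity

lemma tendsto_laplace_shift_of_nonneg (hY : Measurable Y) (hY0 : ∀ᵐ x ∂ν, 0 ≤ Y x)
    (hpos : ∀ ε > 0, ν {x | Y x < ε} ≠ 0) {s : ℝ} (hs : 0 ≤ s) :
    Tendsto (fun t => (∫ x, exp (-((t + s) * Y x)) ∂ν) / ∫ x, exp (-(t * Y x)) ∂ν)
      atTop (nhds 1) := by
  have hLpos : ∀ t ≥ 0, 0 < ∫ x, exp (-(t * Y x)) ∂ν := by
    obtain ⟨p, hp, h⟩ := exists_exp_le_laplace hY hY0 hpos one_pos
    intro t ht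
    exact lt_of_lt_of_le (by positivity) (h t ht)
  have hupper : ∀ᶠ t in atTop,
      (∫ x, exp (-((t + s) * Y x)) ∂ν) / ∫ x, exp (-(t * Y x)) ∂ν ≤ 1 := by
    filter_upwards [eventually_ge_atTop 0] with t ht
    rw [div_le_one (hLpos t ht)]
    refine integral_mono_ae (integrable_exp_neg_mul hY hY0 (by linarith))
      (integrable_exp_neg_mul hY hY0 ht) ?_
    filter_upwards [hY0] with x hx
    exact exp_le_exp.2 (by nlinarith)
  have hlower : ∀ ε > 0, ∃ C : ℝ, ∀ᶠ t in atTop, exp (-(s * ε)) * (1 - C * exp (-(t * (ε / 2)))) ≤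
      (∫ x, exp (-((t + s) * Y x)) ∂ν) / ∫ x, exp (-(t * Y x)) ∂ν := by
    intro ε hε
    obtain ⟨p, hp, h⟩ := exists_exp_le_laplace hY hY0 hpos (half_pos hε)
    refine ⟨ν.real Set.univ / p, ?_⟩
    filter_upwards [eventually_ge_atTop 0] with t ht
    rw [le_div_iff₀ (hLpos t ht)]
    have h1 : exp (-(s * ε)) * ((∫ x, exp (-(t * Y x)) ∂ν) - ν.real Set.univ * exp (-(t * ε))) ≤
        ∫ x, exp (-((t + s) * Y x)) ∂ν := by
      rw [← smul_eq_mul (ν.real Set.univ), ← integral_const,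
        ← integral_sub (integrable_exp_neg_mul hY hY0 ht) (integrable_const _),
        ← integral_const_mul]
      refine integral_mono_ae
        (((integrable_exp_neg_mul hY hY0 ht).sub (integrable_const _)).const_mul _)
        (integrable_exp_neg_mul hY hY0 (by linarith)) ?_
      filter_upwards [hY0] with x hx
      rcases le_total (Y x) ε with hle | hle
      · have e1 : exp (-((t + s) * Y x)) = exp (-(s * Y x)) * exp (-(t * Y x)) := by
          rw [← exp_add]; ring_nf
        rw [e1]
        have e2 : exp (-(s * ε)) ≤ exp (-(s * Y x)) := exp_le_exp.2 (by nlinarith)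
        have e3 := mul_le_mul_of_nonneg_right e2 (exp_pos (-(t * Y x))).le
        have e4 := mul_pos (exp_pos (-(s * ε))) (exp_pos (-(t * ε)))
        linarith
      · have e2 : exp (-(t * Y x)) ≤ exp (-(t * ε)) := exp_le_exp.2 (by nlinarith)
        have e3 := mul_nonneg (exp_pos (-(s * ε))).le (sub_nonneg.2 e2)
        have e4 := exp_pos (-((t + s) * Y x))
        linarith
    refine le_trans ?_ h1
    rw [mul_assoc]
    refine mul_le_mul_of_nonneg_left ?_ (exp_pos _).le
    have h2 : exp (-(t * ε)) = exp (-(t * (ε / 2))) * exp (-(t * (ε / 2))) := by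
      rw [← exp_add]; ring_nf
    have h3 : ν.real Set.univ * exp (-(t * ε)) ≤ ν.real Set.univ / p * exp (-(t * (ε / 2))) *
        ∫ x, exp (-(t * Y x)) ∂ν := by
      calc ν.real Set.univ * exp (-(t * ε))
          = ν.real Set.univ / p * exp (-(t * (ε / 2))) * (p * exp (-(t * (ε / 2)))) := by
            rw [h2]; field_simp
        _ ≤ _ := mul_le_mul_of_nonneg_left (h t ht) (by positivity)
    linarith
  refine tendsto_order.2 ⟨fun r hr => ?_, fun r hr => hupper.mono fun t ht => ht.trans_lt hr⟩
  obtain ⟨ε, hε, hrε⟩ : ∃ ε > 0, r < exp (-(s * ε)) := by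
    have hc : Tendsto (fun ε : ℝ => exp (-(s * ε))) (nhdsWithin 0 (Set.Ioi 0)) (nhds 1) := by
      have : Continuous (fun ε : ℝ => exp (-(s * ε))) := by fun_prop
      simpa using (this.tendsto 0).mono_left nhdsWithin_le_nhds
    obtain ⟨ε, h1, h2⟩ := ((hc.eventually (lt_mem_nhds hr)).and self_mem_nhdsWithin).exists
    exact ⟨ε, h2, h1⟩
  obtain ⟨C, hC⟩ := hlower ε hε
  have hlim : Tendsto (fun t => exp (-(s * ε)) * (1 - C * exp (-(t * (ε / 2))))) atTop
      (nhds (exp (-(s * ε)) * (1 - C * 0))) := by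
    refine ((tendsto_const_nhds).sub (Tendsto.const_mul C ?_)).const_mul _
    exact tendsto_exp_neg_atTop_nhds_zero.comp (tendsto_id.atTop_mul_const (half_pos hε))
  rw [mul_zero, sub_zero, mul_one] at hlim
  filter_upwards [hC, hlim.eventually (lt_mem_nhds hrε)] with t h1 h2
  exact h2.trans_le h1

/-- If `H t` is asymptotic to `exp (-κ t)` times a Laplace transform, up to a doubly exponentially
small error, then shifting the argument of `H` by `s` multiplies it by `exp (-κ s)`. -/
lemma tendsto_shift_of_laplace_bounds (hY : Measurable Y) (hY0 : ∀ᵐ x ∂ν, 0 ≤ Y x)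
    (hpos : ∀ ε > 0, ν {x | Y x < ε} ≠ 0) {κ : ℝ} {H : ℝ → ℝ}
    (hlo : ∀ t > 0, (1 - exp (-t)) * (exp (-(κ * t)) * ∫ x, exp (-(t * Y x)) ∂ν) ≤ H t)
    (hhi : ∀ t > 0, H t ≤ exp (-(κ * t)) * (∫ x, exp (-(t * Y x)) ∂ν) + exp (-exp t)) (s : ℝ) :
    Tendsto (fun t => H (t + s) / H t) atTop (nhds (exp (-(κ * s)))) := by
  set L : ℝ → ℝ := fun t => ∫ x, exp (-(t * Y x)) ∂ν with hL
  obtain ⟨p, hp, hpL⟩ := exists_exp_le_laplace hY hY0 hpos one_pos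
  have hLpos : ∀ t ≥ 0, 0 < L t := fun t ht => lt_of_lt_of_le (by positivity) (hpL t ht)
  have hasymp : Tendsto (fun t => H t / (exp (-(κ * t)) * L t)) atTop (nhds 1) := by
    have hl : Tendsto (fun t : ℝ => 1 - exp (-t)) atTop (nhds 1) := by
      simpa using tendsto_exp_neg_atTop_nhds_zero.const_sub 1
    have hu : Tendsto (fun t : ℝ => 1 + exp ((κ + 1) * t - exp t) / p) atTop (nhds 1) := by
      have h1 : Tendsto (fun t : ℝ => exp t - (κ + 1) * t) atTop atTop := by
        have h2 : Tendsto (fun t : ℝ => t * (exp t / t - (κ + 1))) atTop atTop := by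
          refine tendsto_id.atTop_mul_atTop₀ ?_
          have := tendsto_exp_div_pow_atTop 1
          simp only [pow_one] at this
          exact tendsto_atTop_add_const_right _ _ this
        refine h2.congr' ?_
        filter_upwards [eventually_gt_atTop 0] with t ht
        field_simp
      have h3 := (tendsto_exp_neg_atTop_nhds_zero.comp h1).div_const p
      simpa [Function.comp_def] using h3.const_add 1
    refine tendsto_of_tendsto_of_tendsto_of_le_of_le' hl hu ?_ ?_
    · filter_upwards [eventually_gt_atTop 0] with t ht
      rw [le_div_iff₀ (mul_pos (exp_pos _) (hLpos t ht.le))]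
      exact hlo t ht
    · filter_upwards [eventually_gt_atTop 0] with t ht
      rw [div_le_iff₀ (mul_pos (exp_pos _) (hLpos t ht.le))]
      refine (hhi t ht).trans ?_
      rw [add_mul, one_mul]
      gcongr
      have h1 : exp (-exp t) = exp ((κ + 1) * t - exp t) / p *
          (exp (-(κ * t)) * (p * exp (-(t * 1)))) := by
        have : exp (-exp t) =
            exp ((κ + 1) * t - exp t) * (exp (-(κ * t)) * exp (-(t * 1))) := by
          rw [← exp_add, ← exp_add]; ring_nf
        rw [this]; field_simp
      rw [h1]
      have := hpL t ht.le
      gcongr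
  have hHpos : ∀ t > 0, 0 < H t := by
    intro t ht
    refine lt_of_lt_of_le ?_ (hlo t ht)
    have h1 : exp (-t) < 1 := exp_lt_one_iff.2 (by linarith)
    have := hLpos t ht.le
    have h2 : 0 < 1 - exp (-t) := by linarith
    positivity
  have key : ∀ s ≥ 0, Tendsto (fun t => H (t + s) / H t) atTop (nhds (exp (-(κ * s)))) := by
    intro s hs
    have h1 := hasymp.comp (tendsto_atTop_add_const_right atTop s tendsto_id)
    have h2 := tendsto_laplace_shift_of_nonneg hY hY0 hpos hs
    have h3 := ((h1.div hasymp one_ne_zero).mul h2).mul_const (exp (-(κ * s)))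
    simp only [div_one, one_mul] at h3
    refine h3.congr' ?_
    filter_upwards [eventually_gt_atTop 0] with t ht
    have e1 := hLpos t ht.le
    have e2 := hLpos (t + s) (by linarith)
    have e3 := hHpos t ht
    have e4 : exp (-(κ * (t + s))) = exp (-(κ * t)) * exp (-(κ * s)) := by
      rw [← exp_add]; ring_nf
    change H (t + s) / (exp (-(κ * (t + s))) * L (t + s)) / (H t / (exp (-(κ * t)) * L t)) *
      (L (t + s) / L t) * exp (-(κ * s)) = _
    rw [e4]
    field_simp
  rcases le_total 0 s with hs | hs
  · exact key s hs
  · have h1 := ((key (-s) (by linarith)).comp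
      (tendsto_atTop_add_const_right atTop s tendsto_id)).inv₀ (exp_pos _).ne'
    rw [← exp_neg] at h1
    simpa [Function.comp_def] using h1

end Laplace

/-- Regular variation of a function sandwiched between the values of `H` at the generalised
`1 / u`-quantile of the tail `T`. -/
lemma tendsto_div_of_tail_quantile {T H S : ℝ → ℝ} {κ : ℝ} (hT : Antitone T) (hTpos : ∀ x, 0 < T x)
    (hT0 : Tendsto T atTop (nhds 0)) (hHpos : ∀ x, 0 < H x)
    (hTs : ∀ s, Tendsto (fun t => T (t + s) / T t) atTop (nhds (exp (-s))))
    (hHs : ∀ s, Tendsto (fun t => H (t + s) / H t) atTop (nhds (exp (-(κ * s)))))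
    (hlo : ∀ u x, T x < 1 / u → H x ≤ S u) (hhi : ∀ u x, 1 / u ≤ T x → S u ≤ H x)
    {c : ℝ} (hc : 0 < c) :
    Tendsto (fun u => S (c * u) / S u) atTop (nhds (c ^ (-κ))) := by
  set b : ℝ → ℝ := fun u => sSup {x | 1 / u ≤ T x} with hb
  have hbdd : ∀ u > 0, BddAbove {x | 1 / u ≤ T x} := by
    intro u hu
    obtain ⟨N, hN⟩ := (hT0.eventually (gt_mem_nhds (one_div_pos.2 hu))).exists
    refine ⟨N, fun x hx => ?_⟩
    by_contra! h
    exact absurd (hx.trans (hT h.le)) (not_le.2 hN)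
  have hmem : ∀ N, ∀ᶠ u in atTop, 1 / u ≤ T N := by
    intro N
    filter_upwards [eventually_ge_atTop (1 / T N)] with u hu
    have := hTpos N
    have hu' : 0 < u := lt_of_lt_of_le (by positivity) hu
    rw [div_le_iff₀ this] at hu
    rw [div_le_iff₀ hu']
    linarith
  have hbtop : Tendsto b atTop atTop := by
    refine tendsto_atTop.2 fun N => ?_
    filter_upwards [hmem N, eventually_gt_atTop 0] with u h1 hu
    exact le_csSup (hbdd u hu) h1
  have hblt : ∀ δ > 0, ∀ᶠ u in atTop, T (b u + δ) < 1 / u := by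
    intro δ hδ
    filter_upwards [eventually_gt_atTop 0] with u hu
    by_contra! h
    have := le_csSup (hbdd u hu) h
    change b u + δ ≤ b u at this
    linarith
  have hble : ∀ δ > 0, ∀ᶠ u in atTop, 1 / u ≤ T (b u - δ) := by
    intro δ hδ
    filter_upwards [hmem 0] with u h0
    obtain ⟨x, hx, hlt⟩ := exists_lt_of_lt_csSup (s := {x | 1 / u ≤ T x}) ⟨0, h0⟩
      (show b u - δ < sSup {x | 1 / u ≤ T x} from by change _ < b u; linarith)
    exact le_trans hx (hT hlt.le)
  have hTratio : ∀ δ s, Tendsto (fun u => T (b u + δ + s) / T (b u + δ)) atTop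
      (nhds (exp (-s))) := fun δ s =>
    (hTs s).comp (tendsto_atTop_add_const_right _ δ hbtop)
  have hSlo : ∀ d > 0, ∀ ε > 0, ∀ᶠ u in atTop, H (b u + log d + ε) ≤ S (d * u) := by
    intro d hd ε hε
    have hlt : exp (-(log d + ε / 2)) < 1 / d := by
      rw [neg_add, exp_add, exp_neg, exp_log hd, one_div]
      have : exp (-(ε / 2)) < 1 := exp_lt_one_iff.2 (by linarith)
      have := mul_lt_mul_of_pos_left this (inv_pos.2 hd)
      linarith
    filter_upwards [(hTratio (ε / 2) (log d + ε / 2)).eventually (gt_mem_nhds hlt),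
      hblt (ε / 2) (by linarith), eventually_gt_atTop 0] with u h1 h2 hu
    refine hlo _ _ ?_
    rw [div_lt_iff₀ (hTpos _)] at h1
    have h3 := mul_lt_mul_of_pos_left h2 (one_div_pos.2 hd)
    have h4 : b u + ε / 2 + (log d + ε / 2) = b u + log d + ε := by ring
    rw [h4] at h1
    calc _ < _ := h1
      _ < _ := h3
      _ = _ := by field_simp
  have hShi : ∀ d > 0, ∀ ε > 0, ∀ᶠ u in atTop, S (d * u) ≤ H (b u + log d - ε) := by
    intro d hd ε hε
    have hlt : 1 / d < exp (-(log d - ε / 2)) := by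
      rw [neg_sub, sub_eq_add_neg, exp_add, exp_neg (log d), exp_log hd, one_div]
      have : 1 < exp (ε / 2) := one_lt_exp_iff.2 (by linarith)
      have := mul_lt_mul_of_pos_right this (inv_pos.2 hd)
      linarith
    filter_upwards [(hTratio (-(ε / 2)) (log d - ε / 2)).eventually (lt_mem_nhds hlt),
      hble (ε / 2) (by linarith), eventually_gt_atTop 0] with u h1 h2 hu
    refine hhi _ _ ?_
    rw [lt_div_iff₀ (hTpos _)] at h1
    have h3 := mul_le_mul_of_nonneg_left h2 (one_div_pos.2 hd).le
    have h4 : b u + -(ε / 2) + (log d - ε / 2) = b u + log d - ε := by ring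
    rw [h4, ← sub_eq_add_neg] at h1
    calc 1 / (d * u) = 1 / d * (1 / u) := by field_simp
      _ ≤ _ := h3
      _ ≤ _ := h1.le
  have hHratio : ∀ s s', Tendsto (fun u => H (b u + s') / H (b u + s)) atTop
      (nhds (exp (-(κ * (s' - s))))) := by
    intro s s'
    refine ((hHs (s' - s)).comp (tendsto_atTop_add_const_right _ s hbtop)).congr fun u => ?_
    simp only [Function.comp_apply]
    congr 2
    ring
  have hceq : c ^ (-κ) = exp (-(κ * log c)) := by
    rw [rpow_def_of_pos hc]; ring_nf
  rw [hceq]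
  have hcont : ∀ σ : ℝ, Tendsto (fun ε : ℝ => exp (-(κ * (log c + σ * ε))))
      (nhdsWithin 0 (Set.Ioi 0)) (nhds (exp (-(κ * log c)))) := by
    intro σ
    have : Continuous (fun ε : ℝ => exp (-(κ * (log c + σ * ε)))) := by fun_prop
    simpa using (this.tendsto 0).mono_left nhdsWithin_le_nhds
  refine tendsto_order.2 ⟨fun r hr => ?_, fun r hr => ?_⟩
  · obtain ⟨ε, h1, hε⟩ :=
      (((hcont 2).eventually (lt_mem_nhds hr)).and self_mem_nhdsWithin).exists
    have h2 := hHratio (-ε) (log c + ε)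
    rw [show log c + ε - -ε = log c + 2 * ε by ring] at h2
    filter_upwards [hSlo c hc ε hε, hShi 1 one_pos ε hε, hSlo 1 one_pos ε hε,
      h2.eventually (lt_mem_nhds h1)] with u g1 g2 g3 g4
    simp only [one_mul, log_one, add_zero] at g2 g3
    refine g4.trans_le ?_
    rw [← add_assoc, ← sub_eq_add_neg]
    exact div_le_div₀ ((hHpos _).le.trans g1) g1 ((hHpos _).trans_le g3) g2
  · obtain ⟨ε, h1, hε⟩ :=
      (((hcont (-2)).eventually (gt_mem_nhds hr)).and self_mem_nhdsWithin).exists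
    have h2 := hHratio ε (log c - ε)
    rw [show log c - ε - ε = log c + -2 * ε by ring] at h2
    filter_upwards [hShi c hc ε hε, hSlo 1 one_pos ε hε,
      h2.eventually (gt_mem_nhds h1)] with u g1 g2 g4
    simp only [one_mul, log_one, add_zero] at g2
    refine lt_of_le_of_lt ?_ g4
    rw [← add_sub_assoc]
    exact div_le_div₀ (hHpos _).le g1 (hHpos _) g2

lemma indepFun_measureReal_eq_integral {Ω E : Type*} [MeasurableSpace Ω] [MeasurableSpace E]
    {μ : Measure Ω} [IsProbabilityMeasure μ] {R : Ω → ℝ} {U : Ω → E} (hR : Measurable R)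
    (hU : Measurable U) (hI : IndepFun R U μ) {s : Set (ℝ × E)} (hs : MeasurableSet s) :
    Integrable (fun u => μ.real {ω | (R ω, u) ∈ s}) (μ.map U) ∧
      μ.real {ω | (R ω, U ω) ∈ s} = ∫ u, μ.real {ω | (R ω, u) ∈ s} ∂(μ.map U) := by
  have := Measure.isProbabilityMeasure_map (μ := μ) hR.aemeasurable
  have := Measure.isProbabilityMeasure_map (μ := μ) hU.aemeasurable
  have hsec : ∀ u, μ {ω | (R ω, u) ∈ s} = μ.map R ((fun x => (x, u)) ⁻¹' s) := fun u => by
    rw [Measure.map_apply hR (measurable_prodMk_right hs)]; rfl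
  have hmeas : Measurable fun u => μ {ω | (R ω, u) ∈ s} := by
    simp_rw [hsec]
    exact measurable_measure_prodMk_right hs
  refine ⟨?_, ?_⟩
  · refine Integrable.of_bound (C := 1) hmeas.ennreal_toReal.aestronglyMeasurable ?_
    refine Eventually.of_forall fun u => ?_
    rw [Real.norm_eq_abs, abs_of_nonneg measureReal_nonneg]
    exact measureReal_le_one
  · simp only [Measure.real]
    rw [integral_toReal hmeas.aemeasurable (Eventually.of_forall fun u => measure_lt_top _ _)]
    simp_rw [hsec]
    rw [← Measure.prod_apply_symm hs,
      ← (indepFun_iff_map_prod_eq_prod_map_map hR.aemeasurable hU.aemeasurable).1 hI,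
      Measure.map_apply (hR.prodMk hU) hs]
    rfl

/-- The tails of the unit Gumbel law are exponential up to a factor `1 - exp (-t)`. -/
lemma gumbel_tail_bounds {t z : ℝ} (hz : 0 ≤ z) (hzt : z ≤ exp (-t)) :
    (1 - exp (-t)) * z ≤ 1 - exp (-z) ∧ 1 - exp (-z) ≤ z := by
  have h1 := add_one_le_exp (-z)
  have h2 := add_one_le_exp z
  have h3 : exp (-z) ≤ 1 - z + z ^ 2 := by
    rw [exp_neg, inv_le_iff_one_le_mul₀ (exp_pos z)]
    nlinarith [pow_nonneg hz 3, sq_nonneg (z - 1 / 2)]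
  constructor
  · nlinarith
  · linarith

lemma lt_mul_and_lt_mul_iff_div_min_lt {r x y t : ℝ} (ht : 0 < t) (hm : 0 < min x y) :
    t < r * x ∧ t < r * y ↔ t / min x y < r := by
  rw [div_lt_iff₀ hm]
  constructor
  · rintro ⟨h1, h2⟩
    rcases min_choice x y with h | h <;> rw [h] <;> assumption
  · intro h
    have hr : 0 < r := by
      by_contra! hr
      exact absurd (ht.trans h) (not_lt.2 (mul_nonpos_of_nonpos_of_nonneg hr hm.le))
    exact ⟨h.trans_le (mul_le_mul_of_nonneg_left (min_le_left _ _) hr.le),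
      h.trans_le (mul_le_mul_of_nonneg_left (min_le_right _ _) hr.le)⟩

lemma le_neg_of_lt_mul_of_nonpos {r x t : ℝ} (ht : 0 < t) (hx : x ≤ 0) (hx1 : |x| ≤ 1)
    (h : t < r * x) : r ≤ -t := by
  rw [abs_le] at hx1
  have hr : r < 0 := by
    by_contra! hr
    exact absurd (ht.trans h) (not_lt.2 (mul_nonpos_of_nonneg_of_nonpos hr hx))
  nlinarith

section Gumbel

variable {Ω E : Type*} [MeasurableSpace Ω] [MeasurableSpace E] {μ : Measure Ω}
  [IsProbabilityMeasure μ] {R : Ω → ℝ} {U : Ω → E} {f g : E → ℝ} {a : ℝ}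

lemma gumbel_joint_tail_bounds (hR : Measurable R) (hU : Measurable U) (hI : IndepFun R U μ)
    (hlaw : ∀ x, μ.real {ω | R ω ≤ x} = exp (-exp (-x))) (hf : Measurable f) (hg : Measurable g)
    (hbd : ∀ᵐ u ∂(μ.map U), |f u| ≤ 1 ∧ |g u| ≤ 1) {t : ℝ} (ht : 0 < t) :
    (1 - exp (-t)) * (∫ u in {u | 0 < min (f u) (g u)}, exp (-(t / min (f u) (g u))) ∂(μ.map U)) ≤
        μ.real {ω | t < R ω * f (U ω) ∧ t < R ω * g (U ω)} ∧
      μ.real {ω | t < R ω * f (U ω) ∧ t < R ω * g (U ω)} ≤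
        (∫ u in {u | 0 < min (f u) (g u)}, exp (-(t / min (f u) (g u))) ∂(μ.map U)) +
          exp (-exp t) := by
  have := Measure.isProbabilityMeasure_map (μ := μ) hU.aemeasurable
  set S : Set E := {u | 0 < min (f u) (g u)} with hS
  have hSm : MeasurableSet S := measurableSet_lt measurable_const (hf.min hg)
  have hs : MeasurableSet {p : ℝ × E | t < p.1 * f p.2 ∧ t < p.1 * g p.2} :=
    (measurableSet_lt measurable_const
      (measurable_fst.mul (hf.comp measurable_snd))).inter
      (measurableSet_lt measurable_const (measurable_fst.mul (hg.comp measurable_snd)))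
  obtain ⟨hint, heq⟩ := indepFun_measureReal_eq_integral hR hU hI hs
  simp only [Set.mem_ofPred_eq] at hint heq
  set h : E → ℝ := fun u => μ.real {ω | t < R ω * f u ∧ t < R ω * g u} with hh
  have hnonneg : ∀ u, 0 ≤ h u := fun u => measureReal_nonneg
  have hz1 : ∀ᵐ u ∂(μ.map U), u ∈ S → exp (-(t / min (f u) (g u))) ≤ exp (-t) := by
    filter_upwards [hbd] with u hu hm
    have hm1 : min (f u) (g u) ≤ 1 := (min_le_left _ _).trans (le_of_abs_le hu.1)
    have hm0 : 0 < min (f u) (g u) := hm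
    rw [exp_le_exp, neg_le_neg_iff, le_div_iff₀ hm0]
    nlinarith
  have hon : ∀ u ∈ S, h u = 1 - exp (-exp (-(t / min (f u) (g u)))) := by
    intro u hm
    have : {ω | t < R ω * f u ∧ t < R ω * g u} = {ω | R ω ≤ t / min (f u) (g u)}ᶜ := by
      ext ω
      simp only [Set.mem_ofPred_eq, Set.mem_compl_iff, not_le]
      exact lt_mul_and_lt_mul_iff_div_min_lt ht hm
    rw [hh]
    simp only [this]
    rw [probReal_compl_eq_one_sub (measurableSet_le hR measurable_const), hlaw]
  have hoff : ∀ᵐ u ∂(μ.map U), u ∈ Sᶜ → h u ≤ exp (-exp t) := by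
    filter_upwards [hbd] with u hu hm
    have hlt := hlaw (-t)
    rw [neg_neg] at hlt
    rw [← hlt]
    refine measureReal_mono fun ω hω => ?_
    have hm' : min (f u) (g u) ≤ 0 := not_lt.1 hm
    rcases min_le_iff.1 hm' with hx | hx
    · exact le_neg_of_lt_mul_of_nonpos ht hx hu.1 hω.1
    · exact le_neg_of_lt_mul_of_nonpos ht hx hu.2 hω.2
  have hzint : IntegrableOn (fun u => exp (-(t / min (f u) (g u)))) S (μ.map U) := by
    refine Integrable.of_bound (C := exp (-t))
      (measurable_exp.comp ((hf.min hg).const_div t).neg).aestronglyMeasurable ?_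
    rw [ae_restrict_iff' hSm]
    filter_upwards [hz1] with u hu hm
    rw [Real.norm_eq_abs, abs_of_pos (exp_pos _)]
    exact hu hm
  rw [heq, ← integral_add_compl hSm hint]
  constructor
  · have h1 : (1 - exp (-t)) * (∫ u in S, exp (-(t / min (f u) (g u))) ∂(μ.map U)) ≤
        ∫ u in S, h u ∂(μ.map U) := by
      rw [← integral_const_mul]
      refine setIntegral_mono_on_ae (hzint.const_mul _) hint.integrableOn hSm ?_
      filter_upwards [hz1] with u hu hm
      rw [hon u hm]
      exact (gumbel_tail_bounds (exp_pos _).le (hu hm)).1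
    have h2 : 0 ≤ ∫ u in Sᶜ, h u ∂(μ.map U) := integral_nonneg hnonneg
    linarith
  · refine add_le_add ?_ ?_
    · refine setIntegral_mono_on_ae hint.integrableOn hzint hSm ?_
      filter_upwards [hz1] with u hu hm
      rw [hon u hm]
      exact (gumbel_tail_bounds (exp_pos _).le (hu hm)).2
    · calc ∫ u in Sᶜ, h u ∂(μ.map U) ≤ ∫ u in Sᶜ, exp (-exp t) ∂(μ.map U) :=
            setIntegral_mono_on_ae hint.integrableOn (integrable_const _) hSm.compl hoff
        _ ≤ exp (-exp t) := by
            rw [setIntegral_const, smul_eq_mul]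
            exact mul_le_of_le_one_left (exp_pos _).le measureReal_le_one

/-- Shift asymptotics of the joint tail of `R * f U` and `R * g U` for a Gumbel radius `R`; the
rate is the reciprocal of the essential supremum `a` of `min (f U) (g U)`. -/
lemma gumbel_joint_tail_shift (hR : Measurable R) (hU : Measurable U) (hI : IndepFun R U μ)
    (hlaw : ∀ x, μ.real {ω | R ω ≤ x} = exp (-exp (-x))) (hf : Measurable f) (hg : Measurable g)
    (hbd : ∀ᵐ u ∂(μ.map U), |f u| ≤ 1 ∧ |g u| ≤ 1) (ha : 0 < a)
    (hma : ∀ᵐ u ∂(μ.map U), min (f u) (g u) ≤ a)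
    (hsupp : ∀ b < a, μ.map U {u | b < min (f u) (g u)} ≠ 0) :
    (∀ t, 0 < μ.real {ω | t < R ω * f (U ω) ∧ t < R ω * g (U ω)}) ∧
    ∀ s, Tendsto (fun t => μ.real {ω | t + s < R ω * f (U ω) ∧ t + s < R ω * g (U ω)} /
      μ.real {ω | t < R ω * f (U ω) ∧ t < R ω * g (U ω)}) atTop (nhds (exp (-(a⁻¹ * s)))) := by
  have := Measure.isProbabilityMeasure_map (μ := μ) hU.aemeasurable
  set S : Set E := {u | 0 < min (f u) (g u)} with hS
  have hSm : MeasurableSet S := measurableSet_lt measurable_const (hf.min hg)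
  set H : ℝ → ℝ := fun t => μ.real {ω | t < R ω * f (U ω) ∧ t < R ω * g (U ω)} with hH
  set Y : E → ℝ := fun u => (min (f u) (g u))⁻¹ - a⁻¹ with hYdef
  have hY : Measurable Y := (hf.min hg).inv.sub_const _
  have hY0 : ∀ᵐ u ∂((μ.map U).restrict S), 0 ≤ Y u := by
    rw [ae_restrict_iff' hSm]
    filter_upwards [hma] with u hu hm
    exact sub_nonneg.2 (inv_anti₀ hm hu)
  have hpos : ∀ ε > 0, ((μ.map U).restrict S) {u | Y u < ε} ≠ 0 := by
    intro ε hε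
    have hb : 0 < (a⁻¹ + ε)⁻¹ := by positivity
    have hba : (a⁻¹ + ε)⁻¹ < a := inv_lt_of_inv_lt₀ ha (by linarith)
    rw [Measure.restrict_apply (measurableSet_lt hY measurable_const)]
    refine fun h0 => hsupp _ hba (measure_mono_null (fun u hu => ?_) h0)
    have hu' : (a⁻¹ + ε)⁻¹ < min (f u) (g u) := hu
    refine ⟨?_, hb.trans hu'⟩
    have := inv_lt_of_inv_lt₀ (by positivity) hu'
    change (min (f u) (g u))⁻¹ - a⁻¹ < ε
    linarith
  have hLeq : ∀ t, (∫ u in S, exp (-(t / min (f u) (g u))) ∂(μ.map U)) =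
      exp (-(a⁻¹ * t)) * ∫ u in S, exp (-(t * Y u)) ∂(μ.map U) := by
    intro t
    rw [← integral_const_mul]
    refine integral_congr_ae (Eventually.of_forall fun u => ?_)
    simp only [hYdef]
    rw [← exp_add]
    ring_nf
  have hbounds := fun t (ht : 0 < t) => gumbel_joint_tail_bounds hR hU hI hlaw hf hg hbd ht
  simp only [← hS, hLeq] at hbounds
  refine ⟨fun t => ?_, fun s => tendsto_shift_of_laplace_bounds hY hY0 hpos
    (fun t ht => (hbounds t ht).1) (fun t ht => (hbounds t ht).2) s⟩
  obtain ⟨p, hp, hpL⟩ := exists_exp_le_laplace hY hY0 hpos one_pos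
  have ht1 : 0 < max t 1 := lt_max_of_lt_right one_pos
  have h1 : H (max t 1) ≤ H t := measureReal_mono fun ω hω =>
    ⟨(le_max_left _ _).trans_lt hω.1, (le_max_left _ _).trans_lt hω.2⟩
  refine lt_of_lt_of_le ?_ ((hbounds _ ht1).1.trans h1)
  have h2 : 0 < 1 - exp (-max t 1) := sub_pos.2 (exp_lt_one_iff.2 (by linarith))
  have h3 := (mul_pos hp (exp_pos _)).trans_le (hpL _ ht1.le)
  positivity

end Gumbel

lemma uniformCircle_ne_zero_of_isOpen {V : Set (ℝ × ℝ)} (hV : IsOpen V) {θ : ℝ}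
    (hθ : θ ∈ Set.Icc 0 (2 * π)) (hmem : (cos θ, sin θ) ∈ V) : uniformCircle V ≠ 0 := by
  have hc : Continuous fun θ : ℝ => (cos θ, sin θ) := by fun_prop
  have hpi := pi_pos
  rw [uniformCircle, Measure.map_apply hc.measurable hV.measurableSet, Measure.smul_apply,
    smul_eq_mul, Measure.restrict_apply (hc.measurable hV.measurableSet)]
  refine mul_ne_zero (ENNReal.inv_ne_zero.2 ENNReal.ofReal_ne_top) ?_
  have hcl : θ ∈ closure (Set.Ioo 0 (2 * π)) := by
    rwa [closure_Ioo (by positivity)]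
  have hne := mem_closure_iff.1 hcl _ (hV.preimage hc) hmem
  have hpos := ((hV.preimage hc).inter isOpen_Ioo).measure_pos volume hne
  exact fun h0 => hpos.ne' (measure_mono_null
    (Set.inter_subset_inter_right _ Set.Ioo_subset_Ioc_self) h0)

lemma ae_uniformCircle_sq_add_sq : ∀ᵐ p ∂uniformCircle, p.1 ^ 2 + p.2 ^ 2 = 1 := by
  have hc : Continuous fun θ : ℝ => (cos θ, sin θ) := by fun_prop
  rw [uniformCircle, ae_map_iff hc.aemeasurable (measurableSet_eq_fun (by fun_prop) (by fun_prop))]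
  exact Eventually.of_forall fun θ => by simp

lemma abs_fst_le_one {p : ℝ × ℝ} (hp : p.1 ^ 2 + p.2 ^ 2 = 1) : |p.1| ≤ 1 := by
  rw [← sq_le_one_iff_abs_le_one]
  nlinarith [sq_nonneg p.2]

lemma abs_correlated_le_one {ρ : ℝ} (hρ : ρ ∈ Set.Ioo (-1 : ℝ) 1) {p : ℝ × ℝ}
    (hp : p.1 ^ 2 + p.2 ^ 2 = 1) : |ρ * p.1 + √(1 - ρ ^ 2) * p.2| ≤ 1 := by
  have hs : √(1 - ρ ^ 2) ^ 2 = 1 - ρ ^ 2 := sq_sqrt (by nlinarith [hρ.1, hρ.2])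
  rw [← sq_le_one_iff_abs_le_one]
  have h : (ρ * p.1 + √(1 - ρ ^ 2) * p.2) ^ 2 + (√(1 - ρ ^ 2) * p.1 - ρ * p.2) ^ 2 = 1 := by
    linear_combination (ρ ^ 2 + √(1 - ρ ^ 2) ^ 2) * hp + hs
  nlinarith [sq_nonneg (√(1 - ρ ^ 2) * p.1 - ρ * p.2)]

lemma min_fst_correlated_le {ρ : ℝ} (hρ : ρ ∈ Set.Ioo (-1 : ℝ) 1) {p : ℝ × ℝ}
    (hp : p.1 ^ 2 + p.2 ^ 2 = 1) :
    min p.1 (ρ * p.1 + √(1 - ρ ^ 2) * p.2) ≤ √((1 + ρ) / 2) := by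
  have hs : √(1 - ρ ^ 2) ^ 2 = 1 - ρ ^ 2 := sq_sqrt (by nlinarith [hρ.1, hρ.2])
  set r := √(1 - ρ ^ 2)
  set m := min p.1 (ρ * p.1 + r * p.2) with hm
  have h1 : m ≤ p.1 := min_le_left _ _
  have h2 : m ≤ ρ * p.1 + r * p.2 := min_le_right _ _
  rcases le_total m 0 with h0 | h0
  · exact h0.trans (sqrt_nonneg _)
  refine le_sqrt_of_sq_le ?_
  have h3 : (2 * m) ^ 2 ≤ ((1 + ρ) * p.1 + r * p.2) ^ 2 :=
    pow_le_pow_left₀ (by linarith) (by linarith) 2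
  have h4 : ((1 + ρ) * p.1 + r * p.2) ^ 2 + ((1 + ρ) * p.2 - r * p.1) ^ 2 = 2 + 2 * ρ := by
    linear_combination ((1 + ρ) ^ 2 + r ^ 2) * hp + hs
  nlinarith [sq_nonneg ((1 + ρ) * p.2 - r * p.1)]

lemma exists_angle_fst_eq_correlated {ρ : ℝ} (hρ : ρ ∈ Set.Ioo (-1 : ℝ) 1) :
    ∃ θ ∈ Set.Icc 0 (2 * π), cos θ = √((1 + ρ) / 2) ∧
      ρ * cos θ + √(1 - ρ ^ 2) * sin θ = √((1 + ρ) / 2) := by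
  have hpi := pi_pos
  have h0 := arccos_nonneg ρ
  have h1 := arccos_le_pi ρ
  have hcos : cos (arccos ρ / 2) = √((1 + ρ) / 2) := by
    rw [cos_half (by linarith) h1, cos_arccos hρ.1.le hρ.2.le]
  refine ⟨arccos ρ / 2, ⟨by linarith, by linarith⟩, hcos, ?_⟩
  rw [← hcos, ← sin_arccos]
  nth_rw 1 [← cos_arccos hρ.1.le hρ.2.le]
  rw [← cos_sub]
  ring_nf

/-- Example 1: if the random radius `R` has the unit Gumbel distribution
`Λ(x) = exp(-exp(-x))`, then `u ↦ S̃_u(1,1)` is regularly varying at infinity with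
index `-((1+ρ)/2)^(-1/2)`. -/
theorem Stilde_regularly_varying_gumbel_radius
    {Ω : Type*} [MeasurableSpace Ω] (μ : Measure Ω) [IsProbabilityMeasure μ]
    (R U₁ U₂ : Ω → ℝ) (ρ : ℝ) (hρ : ρ ∈ Set.Ioo (-1 : ℝ) 1)
    (hRmeas : Measurable R) (hUmeas : Measurable fun ω => (U₁ ω, U₂ ω))
    (hIndep : IndepFun R (fun ω => (U₁ ω, U₂ ω)) μ)
    (hUnif : Measure.map (fun ω => (U₁ ω, U₂ ω)) μ = uniformCircle)
    (X₁ X₂ : Ω → ℝ)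
    (hX₁ : X₁ = fun ω => R ω * U₁ ω)
    (hX₂ : X₂ = fun ω => R ω * (ρ * U₁ ω + Real.sqrt (1 - ρ ^ 2) * U₂ ω))
    -- `R` has the unit Gumbel distribution `Λ`
    (F : ℝ → ℝ) (hF : F = fun t => (μ {ω | R ω ≤ t}).toReal)
    (hGumbelLaw : ∀ x : ℝ, F x = Real.exp (-Real.exp (-x)))
    -- `Q` is the distribution function of `X₁`
    (Q : ℝ → ℝ) (hQ : Q = fun t => (μ {ω | X₁ ω ≤ t}).toReal)
    -- the joint survival function `S̃_u(x,y)`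
    (Stilde : ℝ → ℝ → ℝ → ℝ)
    (hStilde : ∀ u x y,
      Stilde u x y = (μ {ω | 1 - x / u < Q (X₁ ω) ∧ 1 - y / u < Q (X₂ ω)}).toReal) :
    ∀ c > (0 : ℝ),
      Tendsto (fun u => Stilde (c * u) 1 1 / Stilde u 1 1) atTop
        (nhds (c ^ (-(((1 + ρ) / 2) ^ (-(1 : ℝ) / 2))))) := by
  intro c hc
  have hV : Measurable fun p : ℝ × ℝ => ρ * p.1 + √(1 - ρ ^ 2) * p.2 := by fun_prop
  have hmin : Continuous fun p : ℝ × ℝ => min p.1 (ρ * p.1 + √(1 - ρ ^ 2) * p.2) := by fun_prop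
  have hlaw : ∀ x, μ.real {ω | R ω ≤ x} = exp (-exp (-x)) := fun x => by
    rw [← hGumbelLaw, hF]; rfl
  have hX₁m : Measurable X₁ := by
    rw [hX₁]; exact hRmeas.mul (measurable_fst.comp hUmeas)
  have hbase : 0 < (1 + ρ) / 2 := by linarith [hρ.1]
  obtain ⟨hTpos, hTs⟩ := gumbel_joint_tail_shift (a := 1) hRmeas hUmeas hIndep hlaw
    measurable_fst measurable_fst
    (by rw [hUnif]; exact ae_uniformCircle_sq_add_sq.mono fun p hp =>
          ⟨abs_fst_le_one hp, abs_fst_le_one hp⟩)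
    one_pos
    (by rw [hUnif]; exact ae_uniformCircle_sq_add_sq.mono fun p hp =>
          (min_le_left _ _).trans (le_of_abs_le (abs_fst_le_one hp)))
    (fun b hb => by
      rw [hUnif]
      refine uniformCircle_ne_zero_of_isOpen (θ := 0)
        (isOpen_lt continuous_const (by fun_prop)) ⟨le_rfl, by positivity⟩ ?_
      simpa using hb)
  obtain ⟨hHpos, hHs⟩ := gumbel_joint_tail_shift (a := √((1 + ρ) / 2)) hRmeas hUmeas hIndep hlaw
    measurable_fst hV
    (by rw [hUnif]; exact ae_uniformCircle_sq_add_sq.mono fun p hp =>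
          ⟨abs_fst_le_one hp, abs_correlated_le_one hρ hp⟩)
    (sqrt_pos.2 hbase)
    (by rw [hUnif]; exact ae_uniformCircle_sq_add_sq.mono fun p hp => min_fst_correlated_le hρ hp)
    (fun b hb => by
      rw [hUnif]
      obtain ⟨θ, hθ, h1, h2⟩ := exists_angle_fst_eq_correlated hρ
      refine uniformCircle_ne_zero_of_isOpen (isOpen_lt continuous_const hmin) hθ ?_
      change b < min (cos θ) (ρ * cos θ + √(1 - ρ ^ 2) * sin θ)
      rwa [h2, h1, min_self])
  have hQcdf : ∀ x, Q x = cdf (μ.map X₁) x := fun x => by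
    have := Measure.isProbabilityMeasure_map (μ := μ) hX₁m.aemeasurable
    rw [cdf_eq_real, map_measureReal_apply hX₁m measurableSet_Iic, hQ]
    rfl
  have hQmono : Monotone Q := fun x y hxy => by
    rw [hQcdf, hQcdf]; exact monotone_cdf _ hxy
  have hT : ∀ x, 1 - Q x = μ.real {ω | x < R ω * U₁ ω ∧ x < R ω * U₁ ω} := fun x => by
    have h1 : {ω | x < R ω * U₁ ω ∧ x < R ω * U₁ ω} = {ω | X₁ ω ≤ x}ᶜ := by
      ext ω; simp [hX₁]
    rw [h1, probReal_compl_eq_one_sub (measurableSet_le hX₁m measurable_const), hQ]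
    rfl
  have hexp : ((1 + ρ) / 2) ^ (-(1 : ℝ) / 2) = (√((1 + ρ) / 2))⁻¹ := by
    rw [sqrt_eq_rpow, ← rpow_neg hbase.le]; norm_num
  rw [hexp]
  simp only [inv_one, one_mul] at hTs
  refine tendsto_div_of_tail_quantile (T := fun x => 1 - Q x)
    (H := fun x => μ.real {ω | x < R ω * U₁ ω ∧ x < R ω * (ρ * U₁ ω + √(1 - ρ ^ 2) * U₂ ω)})
    (S := fun u => Stilde u 1 1) (fun x y hxy => sub_le_sub_left (hQmono hxy) 1)
    (fun x => (hT x).symm ▸ hTpos x) ?_ hHpos ?_ hHs ?_ ?_ hc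
  · simpa [← hQcdf] using (tendsto_cdf_atTop (μ.map X₁)).const_sub 1
  · simpa only [hT] using hTs
  · intro u x hx
    have key : ∀ y, x < y → 1 - 1 / u < Q y := fun y hy => by
      have := hQmono hy.le
      linarith
    change _ ≤ Stilde u 1 1
    rw [hStilde, ← measureReal_def]
    refine measureReal_mono fun ω hω => ⟨key _ ?_, key _ ?_⟩
    · rw [hX₁]; exact hω.1
    · rw [hX₂]; exact hω.2
  · intro u x hx
    have key : ∀ y, 1 - 1 / u < Q y → x < y := fun y hy => by
      by_contra! h
      have := hQmono h
      linarith
    change Stilde u 1 1 ≤ _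
    rw [hStilde, ← measureReal_def]
    refine measureReal_mono fun ω hω => ⟨?_, ?_⟩
    · have := key _ hω.1
      rwa [hX₁] at this
    · have := key _ hω.2
      rwa [hX₂] at this
end

section
/- Suppose the positive random radius R satisfies P(R > u) = (1+o(1)) K u^{N} exp(−r u^{θ}) as u → ∞, for constants K > 0, r > 0, θ > 0, N ∈ ℝ (Kotz Type III). Then the distribution function Q of X₁ satisfies 1 − Q(u) = (1+o(1)) · (K/√(2πrθ)) · u^{N−θ/2} exp(−r u^{θ}) as u → ∞. -/
open MeasureTheory ProbabilityTheory Filter Real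

lemma measure_mul_gt_toReal_eq_integral {Ω : Type*} [MeasurableSpace Ω] (μ : Measure Ω)
    [IsProbabilityMeasure μ] {R U₁ U₂ : Ω → ℝ} (hRmeas : Measurable R)
    (hUmeas : Measurable fun ω => (U₁ ω, U₂ ω))
    (hIndep : IndepFun R (fun ω => (U₁ ω, U₂ ω)) μ)
    (hUnif : Measure.map (fun ω => (U₁ ω, U₂ ω)) μ = uniformCircle) (u : ℝ) :
    (μ {ω | u < R ω * U₁ ω}).toReal =
      (2 * Real.pi)⁻¹ * ∫ t in Set.Ioc 0 (2 * Real.pi), (μ {ω | u < R ω * Real.cos t}).toReal := by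
  have hprod := (indepFun_iff_map_prod_eq_prod_map_map hRmeas.aemeasurable
    hUmeas.aemeasurable).mp hIndep
  have hA : MeasurableSet {p : ℝ × ℝ × ℝ | u < p.1 * p.2.1} :=
    measurableSet_lt measurable_const (by fun_prop)
  have : IsProbabilityMeasure (Measure.map R μ) :=
    Measure.isProbabilityMeasure_map hRmeas.aemeasurable
  have hmeas : Measurable fun y : ℝ × ℝ => Measure.map R μ
      ((fun x => (x, y)) ⁻¹' {p : ℝ × ℝ × ℝ | u < p.1 * p.2.1}) :=
    measurable_measure_prodMk_right hA
  have hcirc : Measurable fun t : ℝ => (Real.cos t, Real.sin t) := by fun_prop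
  have hslice (a b : ℝ) : Measure.map R μ
      ((fun x => (x, (a, b))) ⁻¹' {p : ℝ × ℝ × ℝ | u < p.1 * p.2.1}) = μ {ω | u < R ω * a} := by
    rw [Measure.map_apply hRmeas (hA.preimage (by fun_prop))]
    rfl
  have hslice_meas : Measurable fun t : ℝ => μ {ω | u < R ω * Real.cos t} := by
    simpa only [Function.comp_def, hslice] using hmeas.comp hcirc
  have hmain : μ {ω | u < R ω * U₁ ω} = (ENNReal.ofReal (2 * Real.pi))⁻¹ *
      ∫⁻ t in Set.Ioc 0 (2 * Real.pi), μ {ω | u < R ω * Real.cos t} := by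
    have hjoint : μ {ω | u < R ω * U₁ ω} = Measure.map (fun ω => (R ω, U₁ ω, U₂ ω)) μ
        {p : ℝ × ℝ × ℝ | u < p.1 * p.2.1} := by
      rw [Measure.map_apply (hRmeas.prodMk hUmeas) hA]
      rfl
    rw [hjoint, hprod, Measure.prod_apply_symm hA, hUnif, uniformCircle,
      lintegral_map hmeas hcirc, lintegral_smul_measure, smul_eq_mul]
    simp only [hslice]
  rw [hmain, ENNReal.toReal_mul, ENNReal.toReal_inv,
    ENNReal.toReal_ofReal (by positivity), integral_toReal hslice_meas.aemeasurable
      (Eventually.of_forall fun t => measure_lt_top μ _)]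

lemma integral_measure_mul_cos_gt {Ω : Type*} [MeasurableSpace Ω] (μ : Measure Ω)
    {R : Ω → ℝ} (hR : ∀ᵐ ω ∂μ, 0 < R ω) {u : ℝ} (hu : 0 < u) :
    ∫ t in Set.Ioc 0 (2 * Real.pi), (μ {ω | u < R ω * Real.cos t}).toReal =
      ∫ t in Set.Ioo (-(Real.pi / 2)) (Real.pi / 2), (μ {ω | u / Real.cos t < R ω}).toReal := by
  have hpi := Real.pi_pos
  have hper : Function.Periodic (fun t => (μ {ω | u < R ω * Real.cos t}).toReal)
      (2 * Real.pi) := fun t => by simp only [Real.cos_add_two_pi]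
  have hshift := hper.intervalIntegral_add_eq 0 (-(Real.pi / 2))
  rw [zero_add, intervalIntegral.integral_of_le (by positivity),
    intervalIntegral.integral_of_le (by linarith)] at hshift
  rw [hshift, setIntegral_eq_of_subset_of_forall_sdiff_eq_zero (s := Set.Ioo (-(Real.pi / 2))
    (Real.pi / 2)) measurableSet_Ioc]
  · refine setIntegral_congr_fun measurableSet_Ioo fun t ht => ?_
    simp only [div_lt_iff₀ (Real.cos_pos_of_mem_Ioo ht)]
  · exact fun t ht => ⟨ht.1, by linarith [ht.2]⟩
  · rintro t ⟨⟨ht₁, ht₂⟩, ht₃⟩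
    have hcos : Real.cos t ≤ 0 := by
      refine Real.cos_nonpos_of_pi_div_two_le_of_le ?_ (by linarith)
      by_contra! h
      exact ht₃ ⟨ht₁, h⟩
    have hnull : μ {ω | u < R ω * Real.cos t} = 0 := by
      rw [measure_eq_zero_iff_ae_notMem]
      filter_upwards [hR] with ω hω
      rw [not_lt]
      nlinarith
    rw [hnull, ENNReal.toReal_zero]

lemma cos_sub_one_eq_neg_sq_mul_sinc_sq (x : ℝ) :
    Real.cos x - 1 = -(x ^ 2 / 2) * Real.sinc (x / 2) ^ 2 := by
  rcases eq_or_ne x 0 with rfl | hx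
  · simp
  · have hcos : Real.cos x = 1 - 2 * Real.sin (x / 2) ^ 2 := by
      have h := Real.cos_two_mul (x / 2)
      rw [mul_div_cancel₀ x two_ne_zero] at h
      nlinarith [Real.sin_sq_add_cos_sq (x / 2)]
    rw [hcos, Real.sinc_of_ne_zero (by positivity)]
    field_simp
    ring

lemma tendsto_mul_cos_rpow_sub_one {θ : ℝ} (hθ : 0 < θ) (x : ℝ) :
    Tendsto (fun u : ℝ => u ^ θ * (Real.cos (u ^ (-(θ / 2)) * x) ^ (-θ) - 1)) atTop
      (nhds (θ / 2 * x ^ 2)) := by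
  have hv : Tendsto (fun u : ℝ => u ^ (-(θ / 2)) * x) atTop (nhds 0) := by
    simpa using (tendsto_rpow_neg_atTop (half_pos hθ)).mul_const x
  have hder : HasDerivAt (fun c : ℝ => c ^ (-θ)) (-θ) 1 := by
    simpa using Real.hasDerivAt_rpow_const (x := 1) (p := -θ) (Or.inl one_ne_zero)
  have hslope : Tendsto (fun u : ℝ => dslope (fun c : ℝ => c ^ (-θ)) 1
      (Real.cos (u ^ (-(θ / 2)) * x))) atTop (nhds (-θ)) := by
    have hcont := (continuousAt_dslope_same.mpr hder.differentiableAt).tendsto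
    rw [dslope_same, hder.deriv] at hcont
    refine hcont.comp ?_
    simpa [Function.comp_def] using (Real.continuous_cos.tendsto 0).comp hv
  have hsinc : Tendsto (fun u : ℝ => Real.sinc (u ^ (-(θ / 2)) * x / 2)) atTop (nhds 1) := by
    have h0 : Tendsto (fun u : ℝ => u ^ (-(θ / 2)) * x / 2) atTop (nhds 0) := by
      simpa using hv.div_const 2
    simpa [Function.comp_def] using (Real.continuous_sinc.tendsto 0).comp h0
  have hlim := ((hsinc.pow 2).const_mul (-(x ^ 2 / 2))).mul hslope
  have heq : -(x ^ 2 / 2) * 1 ^ 2 * -θ = θ / 2 * x ^ 2 := by ring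
  rw [heq] at hlim
  refine hlim.congr' ?_
  filter_upwards [eventually_gt_atTop 0] with u hu
  have hds := sub_smul_dslope (fun c : ℝ => c ^ (-θ)) 1 (Real.cos (u ^ (-(θ / 2)) * x))
  simp only [smul_eq_mul, Real.one_rpow] at hds
  have huv : u ^ θ * (u ^ (-(θ / 2))) ^ 2 = 1 := by
    rw [← Real.rpow_natCast, ← Real.rpow_mul hu.le, ← Real.rpow_add hu]
    simp
  rw [← hds, cos_sub_one_eq_neg_sq_mul_sinc_sq]
  linear_combination (-(x ^ 2 / 2) * Real.sinc (u ^ (-(θ / 2)) * x / 2) ^ 2 *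
    dslope (fun c : ℝ => c ^ (-θ)) 1 (Real.cos (u ^ (-(θ / 2)) * x))) * (-huv)

/-- The Kotz tail function `K u ^ N exp (-r u ^ θ)`. -/
noncomputable def kotzTail (K r θ N u : ℝ) : ℝ := K * u ^ N * Real.exp (-r * u ^ θ)

lemma kotzTail_pos {K r θ N u : ℝ} (hK : 0 < K) (hu : 0 < u) : 0 < kotzTail K r θ N u := by
  unfold kotzTail
  positivity

lemma kotzTail_div_div {K r θ N u c : ℝ} (hK : 0 < K) (hu : 0 < u) (hc : 0 < c) :
    kotzTail K r θ N (u / c) / kotzTail K r θ N u =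
      c ^ (-N) * Real.exp (-r * (u ^ θ * (c ^ (-θ) - 1))) := by
  have hexp : Real.exp (-r * (u / c) ^ θ) =
      Real.exp (-r * (u ^ θ * (c ^ (-θ) - 1))) * Real.exp (-r * u ^ θ) := by
    rw [← Real.exp_add, Real.div_rpow hu.le hc.le, Real.rpow_neg hc.le]
    congr 1
    ring
  unfold kotzTail
  rw [hexp, Real.div_rpow hu.le hc.le, Real.rpow_neg hc.le N]
  field_simp

lemma kotzTail_div_div_cos_le {K r θ N u y : ℝ} (hK : 0 < K) (hr : 0 < r) (hθ : 0 < θ)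
    (hu : 0 < u) (hlarge : |N| ≤ r * θ / 2 * u ^ θ)
    (hy : y ∈ Set.Ioo (-(Real.pi / 2)) (Real.pi / 2)) :
    kotzTail K r θ N (u / Real.cos y) / kotzTail K r θ N u ≤
      Real.exp (-(r * θ / Real.pi ^ 2) * (u ^ θ * y ^ 2)) := by
  have hc : 0 < Real.cos y := Real.cos_pos_of_mem_Ioo hy
  rw [kotzTail_div_div hK hu hc, Real.rpow_def_of_pos hc, Real.rpow_def_of_pos hc,
    ← Real.exp_add, Real.exp_le_exp]
  have hlog : Real.log (Real.cos y) ≤ -(2 / Real.pi ^ 2 * y ^ 2) := by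
    have h₁ := Real.log_le_sub_one_of_pos hc
    have h₂ : Real.cos y ≤ 1 - 2 / Real.pi ^ 2 * y ^ 2 :=
      Real.cos_le_one_sub_mul_cos_sq
        (abs_le.mpr ⟨by linarith [hy.1, Real.pi_pos], by linarith [hy.2, Real.pi_pos]⟩)
    linarith
  have hlog0 : Real.log (Real.cos y) ≤ 0 := Real.log_nonpos hc.le (Real.cos_le_one y)
  have hexp := Real.add_one_le_exp (Real.log (Real.cos y) * -θ)
  have huθ : 0 < u ^ θ := Real.rpow_pos_of_pos hu θ
  set l := Real.log (Real.cos y)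
  have h₁ : l * -N ≤ r * θ / 2 * u ^ θ * -l := by
    have hN : l * -N ≤ |N| * -l := by nlinarith [le_abs_self N]
    nlinarith
  have h₂ : r * u ^ θ * (l * -θ) ≤ r * u ^ θ * (Real.exp (l * -θ) - 1) := by
    apply mul_le_mul_of_nonneg_left (by linarith) (by positivity)
  have h₃ : r * θ / 2 * u ^ θ * (2 / Real.pi ^ 2 * y ^ 2) ≤ r * θ / 2 * u ^ θ * -l := by
    apply mul_le_mul_of_nonneg_left (by linarith) (by positivity)
  have h₄ : r * θ / 2 * u ^ θ * (2 / Real.pi ^ 2 * y ^ 2) =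
      r * θ / Real.pi ^ 2 * (u ^ θ * y ^ 2) := by ring
  linarith

/-- Laplace asymptotics of the angular integral of a function with a Kotz tail. -/
lemma tendsto_integral_div_kotzTail {G : ℝ → ℝ} (hGmeas : Measurable G) (hG0 : ∀ u, 0 ≤ G u)
    {K r θ N : ℝ} (hK : 0 < K) (hr : 0 < r) (hθ : 0 < θ)
    (hG : Tendsto (fun u => G u / kotzTail K r θ N u) atTop (nhds 1)) :
    Tendsto (fun u : ℝ => u ^ (θ / 2) *
        (∫ y in Set.Ioo (-(Real.pi / 2)) (Real.pi / 2), G (u / Real.cos y)) /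
          kotzTail K r θ N u) atTop (nhds √(Real.pi / (r * θ / 2))) := by
  set S := Set.Ioo (-(Real.pi / 2)) (Real.pi / 2) with hS
  set f : ℝ → ℝ → ℝ := fun u => S.indicator fun y => G (u / Real.cos y) with hf
  have hfmeas (u : ℝ) : Measurable (f u) :=
    Measurable.indicator (by fun_prop) measurableSet_Ioo
  have hscale : (fun u : ℝ => ∫ x, f u (u ^ (-(θ / 2)) * x) / kotzTail K r θ N u) =ᶠ[atTop]
      fun u : ℝ => u ^ (θ / 2) * (∫ y in S, G (u / Real.cos y)) / kotzTail K r θ N u := by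
    filter_upwards [eventually_gt_atTop 0] with u hu
    rw [integral_div, Measure.integral_comp_mul_left (f u), integral_indicator measurableSet_Ioo,
      Real.rpow_neg hu.le, inv_inv, abs_of_pos (Real.rpow_pos_of_pos hu _), smul_eq_mul]
  refine Tendsto.congr' hscale ?_
  rw [← integral_gaussian]
  have hscale_sq {u : ℝ} (hu : 0 < u) (x : ℝ) : u ^ θ * (u ^ (-(θ / 2)) * x) ^ 2 = x ^ 2 := by
    rw [mul_pow, ← Real.rpow_natCast (u ^ _), ← Real.rpow_mul hu.le, ← mul_assoc,
      ← Real.rpow_add hu]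
    simp
  have hsplit {u y : ℝ} (hu : 0 < u) (hy : y ∈ S) : f u y / kotzTail K r θ N u =
      G (u / Real.cos y) / kotzTail K r θ N (u / Real.cos y) *
        (kotzTail K r θ N (u / Real.cos y) / kotzTail K r θ N u) := by
    have := kotzTail_pos (r := r) (θ := θ) (N := N) hK
      (div_pos hu (Real.cos_pos_of_mem_Ioo hy))
    simp only [hf, Set.indicator_of_mem hy]
    field_simp
  refine tendsto_integral_filter_of_dominated_convergence
    (fun x => 2 * Real.exp (-(r * θ / Real.pi ^ 2) * x ^ 2)) ?_ ?_ ?_ ?_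
  · refine Eventually.of_forall fun u => ?_
    exact (((hfmeas u).comp (measurable_const_mul _)).div_const _).aestronglyMeasurable
  · have hlarge : ∀ᶠ u : ℝ in atTop, |N| ≤ r * θ / 2 * u ^ θ :=
      ((tendsto_rpow_atTop hθ).const_mul_atTop (by positivity)).eventually_ge_atTop _
    obtain ⟨A, hA⟩ := eventually_atTop.mp (hG.eventually_le_const one_lt_two)
    filter_upwards [hlarge, eventually_gt_atTop 0, eventually_ge_atTop A] with u hlu hu hAu
    refine Eventually.of_forall fun x => ?_
    have hpos := kotzTail_pos (r := r) (θ := θ) (N := N) hK hu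
    by_cases hy : u ^ (-(θ / 2)) * x ∈ S
    · have hc := Real.cos_pos_of_mem_Ioo hy
      have hcu : u ≤ u / Real.cos (u ^ (-(θ / 2)) * x) :=
        le_div_self hu.le hc (Real.cos_le_one _)
      have hpos' := kotzTail_pos (r := r) (θ := θ) (N := N) hK (div_pos hu hc)
      have hle := kotzTail_div_div_cos_le (K := K) hK hr hθ hu hlu hy
      rw [hscale_sq hu] at hle
      rw [hsplit hu hy, Real.norm_of_nonneg 
          (mul_nonneg (div_nonneg (hG0 _) hpos'.le) (by positivity))]
      exact mul_le_mul (hA _ (hAu.trans hcu)) hle (by positivity) zero_le_two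
    · simp only [hf, Set.indicator_of_notMem hy, zero_div, norm_zero]
      positivity
  · exact (integrable_exp_neg_mul_sq (by positivity)).const_mul 2
  · refine Eventually.of_forall fun x => ?_
    have hv : Tendsto (fun u : ℝ => u ^ (-(θ / 2)) * x) atTop (nhds 0) := by
      simpa using (tendsto_rpow_neg_atTop (half_pos hθ)).mul_const x
    have hcos : Tendsto (fun u : ℝ => Real.cos (u ^ (-(θ / 2)) * x)) atTop (nhds 1) := by
      simpa [Function.comp_def] using (Real.continuous_cos.tendsto 0).comp hv
    have hS_mem : ∀ᶠ u : ℝ in atTop, u ^ (-(θ / 2)) * x ∈ S :=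
      hv.eventually (Ioo_mem_nhds (by linarith [Real.pi_pos]) (by linarith [Real.pi_pos]))
    have hquot : Tendsto (fun u : ℝ => u / Real.cos (u ^ (-(θ / 2)) * x)) atTop atTop := by
      refine tendsto_atTop_mono' atTop ?_ tendsto_id
      filter_upwards [hS_mem, eventually_gt_atTop 0] with u hy hu
      exact le_div_self hu.le (Real.cos_pos_of_mem_Ioo hy) (Real.cos_le_one _)
    have hexp := (Real.continuous_exp.tendsto _).comp
      ((tendsto_mul_cos_rpow_sub_one hθ x).const_mul (-r))
    have hpow : Tendsto (fun u : ℝ => Real.cos (u ^ (-(θ / 2)) * x) ^ (-N)) atTop (nhds 1) := by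
      simpa using hcos.rpow_const (p := -N) (Or.inl one_ne_zero)
    have hlim := (hG.comp hquot).mul (hpow.mul hexp)
    have heq : 1 * (1 * Real.exp (-r * (θ / 2 * x ^ 2))) = Real.exp (-(r * θ / 2) * x ^ 2) := by
      rw [one_mul, one_mul]
      congr 1
      ring
    rw [heq] at hlim
    refine hlim.congr' ?_
    filter_upwards [hS_mem, eventually_gt_atTop 0] with u hy hu
    rw [hsplit hu hy, kotzTail_div_div hK hu (Real.cos_pos_of_mem_Ioo hy)]
    rfl

/-- Example 3 (Kotz Type III): if `P(R > u) = (1+o(1)) K u^N exp(-r u^θ)` as `u → ∞`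
(`K, r, θ > 0`, `N ∈ ℝ`), then `1 - Q(u) = (1+o(1)) (K/√(2πrθ)) u^(N-θ/2) exp(-r u^θ)`. -/
theorem kotz_marginal_tail
    {Ω : Type*} [MeasurableSpace Ω] (μ : Measure Ω) [IsProbabilityMeasure μ]
    (R U₁ U₂ : Ω → ℝ) (ρ : ℝ) (hρ : ρ ∈ Set.Ioo (-1 : ℝ) 1)
    (hRmeas : Measurable R) (hUmeas : Measurable fun ω => (U₁ ω, U₂ ω))
    (hIndep : IndepFun R (fun ω => (U₁ ω, U₂ ω)) μ)
    (hUnif : Measure.map (fun ω => (U₁ ω, U₂ ω)) μ = uniformCircle)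
    (X₁ X₂ : Ω → ℝ)
    (hX₁ : X₁ = fun ω => R ω * U₁ ω)
    (hX₂ : X₂ = fun ω => R ω * (ρ * U₁ ω + Real.sqrt (1 - ρ ^ 2) * U₂ ω))
    -- `F` is the distribution function of the positive random radius `R`
    (F : ℝ → ℝ) (hF : F = fun t => (μ {ω | R ω ≤ t}).toReal)
    (hF0 : F 0 = 0) (hFlt : ∀ x > (0 : ℝ), F x < 1)
    -- `Q` is the distribution function of `X₁`
    (Q : ℝ → ℝ) (hQ : Q = fun t => (μ {ω | X₁ ω ≤ t}).toReal)
    -- Kotz Type III tail: `P(R > u) = (1+o(1)) K u^N exp(-r u^θ)` as `u → ∞`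
    (K r θ : ℝ) (hK : 0 < K) (hr : 0 < r) (hθ : 0 < θ) (N : ℝ)
    (hKotz : Tendsto
      (fun u => (μ {ω | u < R ω}).toReal / (K * u ^ N * Real.exp (-r * u ^ θ)))
      atTop (nhds 1)) :
    Tendsto
      (fun u => (1 - Q u) /
        (K / Real.sqrt (2 * Real.pi * r * θ) * u ^ (N - θ / 2) * Real.exp (-r * u ^ θ)))
      atTop (nhds 1) := by
  have hRpos : ∀ᵐ ω ∂μ, 0 < R ω := by
    have hnull : μ {ω | R ω ≤ 0} = 0 := by
      rw [hF] at hF0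
      exact ((ENNReal.toReal_eq_zero_iff _).mp hF0).resolve_right (measure_ne_top μ _)
    filter_upwards [measure_eq_zero_iff_ae_notMem.mp hnull] with ω hω
    exact not_le.mp hω
  have hanti : Antitone fun u => (μ {ω | u < R ω}).toReal := fun a b hab =>
    ENNReal.toReal_mono (measure_ne_top μ _) (measure_mono fun ω (hω : b < R ω) => hab.trans_lt hω)
  have hlaplace := (tendsto_integral_div_kotzTail hanti.measurable
    (fun u => ENNReal.toReal_nonneg) hK hr hθ hKotz).const_mul
      ((2 * Real.pi)⁻¹ * √(2 * Real.pi * r * θ))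
  have hpi := Real.pi_pos
  have hconst : (2 * Real.pi)⁻¹ * √(2 * Real.pi * r * θ) * √(Real.pi / (r * θ / 2)) = 1 := by
    have hsq : 2 * Real.pi * r * θ * (Real.pi / (r * θ / 2)) = (2 * Real.pi) ^ 2 := by
      field_simp
    rw [mul_assoc, ← Real.sqrt_mul (by positivity), hsq, Real.sqrt_sq (by positivity)]
    field_simp
  rw [hconst] at hlaplace
  refine hlaplace.congr' ?_
  filter_upwards [eventually_gt_atTop 0] with u hu
  have htail : 1 - Q u = (μ {ω | u < R ω * U₁ ω}).toReal := by
    have hset : MeasurableSet {ω | R ω * U₁ ω ≤ u} :=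
      measurableSet_le (hRmeas.mul hUmeas.fst) measurable_const
    have hcompl : {ω | u < R ω * U₁ ω} = {ω | R ω * U₁ ω ≤ u}ᶜ := by
      ext ω
      simp
    rw [hcompl, hQ, hX₁]
    exact (probReal_compl_eq_one_sub hset).symm
  rw [htail, measure_mul_gt_toReal_eq_integral μ hRmeas hUmeas hIndep hUnif,
    integral_measure_mul_cos_gt μ hRpos hu, Real.rpow_sub hu, kotzTail]
  have := Real.rpow_pos_of_pos hu (θ / 2)
  have := Real.rpow_pos_of_pos hu N
  have : 0 < √(2 * Real.pi * r * θ) := by positivity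
  field_simp
end
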